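/- arXiv:2604.13342 — 3 statements merged into one kernel-verified Lean document; each statement's English description precedes it below -/
import Mathlib

section
/- Let A = (a₁, a₂) : ℝ² → ℝ² be a bounded C¹ vector potential whose associated magnetic field B = ∂ₓa₂ − ∂_y a₁ is continuously differentiable, compactly supported inside the straight strip Ω₀ = ℝ × (0, π), and not identically zero. Then there exists α₀ > 0 such that for every function f : ℝ → [0, ∞) which is three times continuously differentiable and satisfies |f(x)| ≤ α/(1+x²), |f'(x)| ≤ α/(1+x²), |f''(x)| ≤ α/(1+x²), |f'''(x)| ≤ α/(1+x²) for all x ∈ ℝ with some α < α₀, and for every smooth ψ : ℝ² → ℂ compactly supported in the deformed strip Ω_f = {(x,y) ∈ ℝ² : 0 < y < π(1+f(x))}, one has ∫_{Ω_f} |i∇ψ(x,y) + A(x,y)ψ(x,y)|² dx dy ≥ ∫_{Ω_f} |ψ(x,y)|² dx dy. (This is the quadratic-form formulation of the absence of spectrum of the magnetic Dirichlet Laplacian (i∇+A)² on Ω_f below the threshold 1 of the essential spectrum.) -/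
open MeasureTheory Real

lemma young_aux (s P u M k κ : ℝ) (hk : 0 < k) (hκ : 0 < κ) (hs : |s| ≤ M) :
    s * P * u ≤ k * M ^ 2 / κ * P ^ 2 + κ * u ^ 2 / (4 * k) := by
  have h1 : s ^ 2 ≤ M ^ 2 := sq_le_sq' (by linarith [neg_abs_le s]) (le_trans (le_abs_self s) hs)
  have h2 : k * s ^ 2 / κ * P ^ 2 ≤ k * M ^ 2 / κ * P ^ 2 := by gcongr
  have h3 : k * s ^ 2 / κ * P ^ 2 + κ * u ^ 2 / (4 * k) - s * P * u
      = (2 * k * s * P - κ * u) ^ 2 / (4 * k * κ) := by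
    field_simp; ring
  have h4 : 0 ≤ (2 * k * s * P - κ * u) ^ 2 / (4 * k * κ) := by positivity
  linarith

lemma two_aux (B p t m : ℝ) (hB : |B| ≤ m) : 2 * B * (p * t) ≤ m * (p ^ 2 + t ^ 2) := by
  have h := abs_le.mp hB
  nlinarith [sq_nonneg (p - t), sq_nonneg (p + t), mul_nonneg (sub_nonneg.2 h.2) (sq_nonneg (p+t)),
    mul_nonneg (sub_nonneg.2 h.1) (sq_nonneg (p-t)), mul_nonneg (sub_nonneg.2 h.2) (sq_nonneg (p-t)),
    mul_nonneg (sub_nonneg.2 h.1) (sq_nonneg (p+t))]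

/-- the commutator estimate, pointwise -/
lemma comm_aux (m C0 κ k : ℝ) (hm : 0 ≤ m) (hC0 : 0 ≤ C0) (hκ : 0 < κ) (hk : 0 < k)
    (u v P1 P2 T1 T2 c B Bx By D : ℝ) (hD0 : 0 < D)
    (hB : (|B| ≤ m ∧ |Bx| ≤ m ∧ |By| ≤ m ∧ κ ≤ D ∧ |c| ≤ C0) ∨ (B = 0 ∧ Bx = 0 ∧ By = 0)) :
    2 * B * ((P1 * T2 - P2 * T1) + c * (P1 * u + P2 * v)) + By * (u * P1 + v * P2)
      - Bx * (u * T1 + v * T2)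
    ≤ (m + k * (2 * m * C0 + m) ^ 2 / κ) * (P1 ^ 2 + P2 ^ 2 + T1 ^ 2 + T2 ^ 2)
      + D * (u ^ 2 + v ^ 2) / (2 * k) := by
  rcases hB with ⟨hB, hBx, hBy, hD, hc⟩ | ⟨rfl, rfl, rfl⟩
  · have hs : |2 * B * c + By| ≤ 2 * m * C0 + m := by
      calc |2 * B * c + By| ≤ |2 * B * c| + |By| := abs_add_le _ _
        _ = 2 * (|B| * |c|) + |By| := by rw [abs_mul, abs_mul]; norm_num; ring
        _ ≤ 2 * (m * C0) + m := by gcongr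
        _ = _ := by ring
    have hs' : |-Bx| ≤ 2 * m * C0 + m := by
      rw [abs_neg]; nlinarith [mul_nonneg hm hC0]
    have e1 := young_aux _ P1 u _ k κ hk hκ hs
    have e2 := young_aux _ P2 v _ k κ hk hκ hs
    have e3 := young_aux _ T1 u _ k κ hk hκ hs'
    have e4 := young_aux _ T2 v _ k κ hk hκ hs'
    have e5 := two_aux B P1 T2 m hB
    have e6 := two_aux (-B) P2 T1 m (by rwa [abs_neg])
    have e7 : κ * (u ^ 2 + v ^ 2) / (2 * k) ≤ D * (u ^ 2 + v ^ 2) / (2 * k) := by gcongr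
    have e8 : κ * (u ^ 2 + v ^ 2) / (2 * k) = 2 * (κ * u ^ 2 / (4 * k)) + 2 * (κ * v ^ 2 / (4 * k)) := by
      field_simp; ring
    set A := k * (2 * m * C0 + m) ^ 2 / κ
    nlinarith
  · have : 0 ≤ D * (u ^ 2 + v ^ 2) / (2 * k) := by positivity
    have : 0 ≤ (m + k * (2 * m * C0 + m) ^ 2 / κ) * (P1 ^ 2 + P2 ^ 2 + T1 ^ 2 + T2 ^ 2) := by positivity
    simp only [mul_zero, zero_mul, sub_zero, add_zero]; linarith

lemma alg_main (c1 C2 c3 C4 m C0 κ : ℝ) (hc1 : 0 < c1) (hC2 : 0 ≤ C2) (hc3 : 0 < c3) (hC4 : 0 ≤ C4)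
    (hm : 0 ≤ m) (hC0 : 0 ≤ C0) (hκ : 0 < κ) :
    ∃ k1 k2 k3 α₀ : ℝ, 0 < α₀ ∧ ∀ (u v ux uy vx vy uxy vxy a1 a2 a2x a1y c g B Bx By w w' z z' e D α : ℝ),
      0 < D → 0 ≤ e → e ≤ 1 →
      B = a2x - a1y →
      c1 * D - C2 * e ≤ w' - w ^ 2 →
      e * c3 - C4 * B ^ 2 ≤ e * (z' + 2 * z * c - z ^ 2) →
      ((|B| ≤ m ∧ |Bx| ≤ m ∧ |By| ≤ m ∧ κ ≤ D ∧ |c| ≤ C0) ∨ (B = 0 ∧ Bx = 0 ∧ By = 0)) →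
      1 - g ^ 2 ≤ 2 * α * D → α ≤ α₀ →
      (((-(g ^ 2 + c ^ 2)) * (u ^ 2 + v ^ 2) + c * (2 * (u * uy + v * vy)))
        - k1 * (w' * (u ^ 2 + v ^ 2) + w * (2 * (u * ux + v * vx)))
        - k2 * (e * (z' * (u ^ 2 + v ^ 2) + z * (2 * (u * uy + v * vy))))
        + k3 * ((By * (a1 * (u ^ 2 + v ^ 2) - u * vx + v * ux)
              + B * (a1y * (u ^ 2 + v ^ 2) + a1 * (2 * (u * uy + v * vy))
                - uy * vx - u * vxy + vy * ux + v * uxy))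
            - (Bx * (a2 * (u ^ 2 + v ^ 2) - u * vy + v * uy)
              + B * (a2x * (u ^ 2 + v ^ 2) + a2 * (2 * (u * ux + v * vx))
                - ux * vy - u * vxy + vx * uy + v * uxy))))
      ≤ (a1 * u - vx) ^ 2 + (ux + a1 * v) ^ 2 + (a2 * u - vy) ^ 2 + (uy + a2 * v) ^ 2
        - (u ^ 2 + v ^ 2) := by
  set k : ℝ := C2 * C4 / (c3 * c1) + 1 with hk
  have hkpos : 0 < k := by positivity
  set C5 : ℝ := m + k * (2 * m * C0 + m) ^ 2 / κ with hC5
  have hC5n : 0 ≤ C5 := by positivity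
  set A : ℝ := 1 + C2 / c3 + C2 * C4 * C5 / c3 with hA
  have hApos : 0 < A := by positivity
  refine ⟨1 / A, C2 / c3 / A, C2 * C4 / c3 / A, c1 / (4 * A), by positivity, ?_⟩
  intro u v ux uy vx vy uxy vxy a1 a2 a2x a1y c g B Bx By w w' z z' e D α hD he he1 hB h1 h2 h3 h4 hα
  set P1 := a1 * u - vx with hP1
  set P2 := ux + a1 * v with hP2
  set T1 := a2 * u - vy + c * v with hT1
  set T2 := uy + a2 * v - c * u with hT2
  set ρ := u ^ 2 + v ^ 2 with hρ
  have hρ0 : 0 ≤ ρ := by positivity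
  set d1 := w' * ρ + w * (2 * (u * ux + v * vx)) with hd1
  set d2 := e * (z' * ρ + z * (2 * (u * uy + v * vy))) with hd2
  set d5 := (-(g ^ 2 + c ^ 2)) * ρ + c * (2 * (u * uy + v * vy)) with hd5
  set d3 := ((By * (a1 * ρ - u * vx + v * ux)
              + B * (a1y * ρ + a1 * (2 * (u * uy + v * vy))
                - uy * vx - u * vxy + vy * ux + v * uxy))
            - (Bx * (a2 * ρ - u * vy + v * uy)
              + B * (a2x * ρ + a2 * (2 * (u * ux + v * vx))
                - ux * vy - u * vxy + vx * uy + v * uxy))) with hd3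
  set X := P1 ^ 2 + P2 ^ 2 with hX
  set Y := T1 ^ 2 + T2 ^ 2 with hY
  have hX0 : 0 ≤ X := by positivity
  have hY0 : 0 ≤ Y := by positivity
  have I1 : c1 * (D * ρ) ≤ X + C2 * (e * ρ) + d1 := by
    have q1 : 0 ≤ (P1 - w * v) ^ 2 + (P2 + w * u) ^ 2 := by positivity
    have q2 : (P1 - w * v) ^ 2 + (P2 + w * u) ^ 2 = X + w ^ 2 * ρ + w * (2 * (u * ux + v * vx)) := by
      simp only [hX, hP1, hP2, hρ]; ring
    have q3 := mul_le_mul_of_nonneg_right h1 hρ0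
    have q5 : (c1 * D - C2 * e) * ρ = c1 * (D * ρ) - C2 * (e * ρ) := by ring
    have q6 : (w' - w ^ 2) * ρ = w' * ρ - w ^ 2 * ρ := by ring
    rw [hd1]; clear_value X P1 P2 T1 T2 ρ d1 d2 d3 d5 Y; linarith
  have I2 : c3 * (e * ρ) ≤ Y + C4 * (B ^ 2 * ρ) + d2 := by
    have q1 : 0 ≤ e * ((T1 - z * v) ^ 2 + (T2 + z * u) ^ 2) := by positivity
    have q2 : e * ((T1 - z * v) ^ 2 + (T2 + z * u) ^ 2)
        = e * Y + e * (z ^ 2 * ρ + z * (2 * (u * uy + v * vy)) - 2 * z * c * ρ) := by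
      simp only [hY, hT1, hT2, hρ]; ring
    have q3 := mul_le_mul_of_nonneg_right h2 hρ0
    have q4 : e * Y ≤ Y := mul_le_of_le_one_left hY0 he1
    have q5 : (e * c3 - C4 * B ^ 2) * ρ = c3 * (e * ρ) - C4 * (B ^ 2 * ρ) := by ring
    have q6 : d2 + e * (z ^ 2 * ρ + z * (2 * (u * uy + v * vy)) - 2 * z * c * ρ)
        - e * (z ^ 2 * ρ + z * (2 * (u * uy + v * vy)) - 2 * z * c * ρ) = 
        (e * (z' + 2 * z * c - z ^ 2)) * ρ
        + e * (z ^ 2 * ρ + z * (2 * (u * uy + v * vy)) - 2 * z * c * ρ) := by rw [hd2]; ring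
    clear_value X P1 P2 T1 T2 ρ d1 d2 d3 d5 Y; linarith
  have I3 : B ^ 2 * ρ + d3 ≤ C5 * (X + Y) + D * ρ / (2 * k) := by
    have q := comm_aux m C0 κ k hm hC0 hκ hkpos u v P1 P2 T1 T2 c B Bx By D hD h3
    have q2 : B ^ 2 * ρ + d3 = 2 * B * ((P1 * T2 - P2 * T1) + c * (P1 * u + P2 * v))
        + By * (u * P1 + v * P2) - Bx * (u * T1 + v * T2) := by
      have : B ^ 2 * ρ = B * (a2x - a1y) * ρ := by rw [← hB]; ring
      rw [this]
      simp only [hd3, hP1, hP2, hT1, hT2, hρ]; ring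
    rw [q2]; refine q.trans (le_of_eq ?_)
    simp only [hX, hY]; ring
  have hfin : (a1 * u - vx) ^ 2 + (ux + a1 * v) ^ 2 + (a2 * u - vy) ^ 2 + (uy + a2 * v) ^ 2 - ρ
      = X + Y - (1 - g ^ 2) * ρ + d5 := by
    simp only [hX, hY, hd5, hP1, hP2, hT1, hT2, hρ]; ring
  have hDρ : 0 ≤ D * ρ := by positivity
  -- combine
  have J2 : C2 * (e * ρ) ≤ C2 / c3 * (Y + C4 * (B ^ 2 * ρ) + d2) := by
    have := mul_le_mul_of_nonneg_left I2 (show 0 ≤ C2 / c3 by positivity)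
    have e1 : C2 / c3 * (c3 * (e * ρ)) = C2 * (e * ρ) := by field_simp
    linarith
  have J3 : C2 * C4 / c3 * (B ^ 2 * ρ) ≤ C2 * C4 / c3 * (C5 * (X + Y) + D * ρ / (2 * k) - d3) :=
    mul_le_mul_of_nonneg_left (by linarith) (by positivity)
  have J4 : C2 * C4 / c3 * (D * ρ / (2 * k)) ≤ c1 / 2 * (D * ρ) := by
    have : C2 * C4 / c3 ≤ c1 * k := by
      rw [hk]; have : c1 * (C2 * C4 / (c3 * c1) + 1) = C2 * C4 / c3 + c1 := by field_simp
      linarith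
    calc C2 * C4 / c3 * (D * ρ / (2 * k)) ≤ c1 * k * (D * ρ / (2 * k)) := by gcongr
      _ = _ := by field_simp
  have J5 : c1 / 2 * (D * ρ) ≤ A * (X + Y) + d1 + C2 / c3 * d2 - C2 * C4 / c3 * d3 := by
    have e1 : A * (X + Y) = (X + Y) + C2 / c3 * X + C2 / c3 * Y + C2 * C4 / c3 * (C5 * (X + Y)) := by
      rw [hA]; ring
    have e2 : 0 ≤ C2 / c3 * X := by positivity
    have e3 : C2 / c3 * (Y + C4 * (B ^ 2 * ρ) + d2) = C2 / c3 * Y + C2 * C4 / c3 * (B ^ 2 * ρ) + C2 / c3 * d2 := by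
      ring
    have e4 : C2 * C4 / c3 * (C5 * (X + Y) + D * ρ / (2 * k) - d3) = C2 * C4 / c3 * (C5 * (X + Y))
      + C2 * C4 / c3 * (D * ρ / (2 * k)) - C2 * C4 / c3 * d3 := by ring
    linarith
  have J6 : (1 - g ^ 2) * ρ ≤ 1 / A * (c1 / 2 * (D * ρ)) := by
    calc (1 - g ^ 2) * ρ ≤ (2 * α * D) * ρ := by gcongr
      _ = 2 * α * (D * ρ) := by ring
      _ ≤ 2 * (c1 / (4 * A)) * (D * ρ) := by gcongr
      _ = _ := by field_simp; ring
  have J7 := mul_le_mul_of_nonneg_left J5 (show 0 ≤ 1 / A by positivity)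
  have J8 : 1 / A * (A * (X + Y) + d1 + C2 / c3 * d2 - C2 * C4 / c3 * d3)
     = X + Y + 1 / A * d1 + C2 / c3 / A * d2 - C2 * C4 / c3 / A * d3 := by field_simp
  rw [hfin]
  linarith

lemma hardy_x (x0 r : ℝ) (hr : 0 < r) : ∃ (w : ℝ → ℝ) (c1 C2 : ℝ), ContDiff ℝ 1 w ∧ 0 < c1 ∧ 0 ≤ C2 ∧
    ∀ x, c1 * (1 / (1 + x ^ 2)) - C2 ≤ deriv w x - w x ^ 2 ∧
      (r < |x - x0| → c1 * (1 / (1 + x ^ 2)) ≤ deriv w x - w x ^ 2) := by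
  set δ := r / 3 with hδ
  have hδ0 : 0 < δ := by positivity
  have hden : ∀ x : ℝ, 0 < (x - x0) ^ 2 + δ ^ 2 := fun x => by positivity
  set M := 2 + 2 * x0 ^ 2 + δ ^ 2 with hM
  have hM0 : 0 < M := by positivity
  refine ⟨fun x => -(x - x0) / (2 * ((x - x0) ^ 2 + δ ^ 2)), 1 / (8 * M), 3 / (4 * δ ^ 2), ?_,
    by positivity, by positivity, ?_⟩
  · refine ContDiff.div (by fun_prop) (by fun_prop) ?_
    intro x; have := hden x; positivity
  intro x
  set t := x - x0 with ht
  have hd : deriv (fun x => -(x - x0) / (2 * ((x - x0) ^ 2 + δ ^ 2))) x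
      - (-(x - x0) / (2 * ((x - x0) ^ 2 + δ ^ 2))) ^ 2
      = 1 / (4 * (t ^ 2 + δ ^ 2)) - 3 * δ ^ 2 / (4 * (t ^ 2 + δ ^ 2) ^ 2) := by
    have h1 : HasDerivAt (fun x : ℝ => -(x - x0)) (-1) x := ((hasDerivAt_id x).sub_const x0).neg
    have h2 : HasDerivAt (fun x : ℝ => 2 * ((x - x0) ^ 2 + δ ^ 2)) (2 * (2 * t)) x := by
      have := ((((hasDerivAt_id x).sub_const x0).pow 2).add_const (δ ^ 2)).const_mul 2
      refine HasDerivAt.congr_deriv (f := fun x : ℝ => 2 * ((x - x0) ^ 2 + δ ^ 2)) this ?_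
      simp [ht]
    have hne : (2 * ((x - x0) ^ 2 + δ ^ 2)) ≠ 0 := by have := hden x; positivity
    have h3 := h1.div h2 hne
    have h3' := h3.deriv
    rw [show (fun x : ℝ => -(x - x0)) / (fun x : ℝ => 2 * ((x - x0) ^ 2 + δ ^ 2)) = fun x => -(x - x0) / (2 * ((x - x0) ^ 2 + δ ^ 2)) from rfl] at h3'
    rw [h3']
    have := hden x
    rw [← ht] at *
    field_simp
    ring
  beta_reduce
  rw [hd]
  have hS : 0 < t ^ 2 + δ ^ 2 := hden x
  have hb : t ^ 2 + δ ^ 2 ≤ M * (1 + x ^ 2) := by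
    rw [hM, ht]; nlinarith [sq_nonneg (x + x0), sq_nonneg (x0 * x), sq_nonneg (δ * x), sq_nonneg (x-x0)]
  have hc : 1 / (8 * M) * (1 / (1 + x ^ 2)) ≤ 1 / (8 * (t ^ 2 + δ ^ 2)) := by
    rw [one_div_mul_one_div]
    apply one_div_le_one_div_of_le (by positivity); linarith
  have hhalf : 1 / (8 * (t ^ 2 + δ ^ 2)) ≤ 1 / (4 * (t ^ 2 + δ ^ 2)) :=
    one_div_le_one_div_of_le (by positivity) (by linarith)
  constructor
  · have : 3 * δ ^ 2 / (4 * (t ^ 2 + δ ^ 2) ^ 2) ≤ 3 / (4 * δ ^ 2) := by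
      rw [div_le_div_iff₀ (by positivity) (by positivity)]
      nlinarith [sq_nonneg t, sq_nonneg δ, sq_nonneg (t*t), sq_nonneg (t * δ)]
    linarith
  · intro hrt
    have ht2 : (3 * δ) ^ 2 ≤ t ^ 2 := by
      rw [← sq_abs t]; apply pow_le_pow_left₀ (by positivity); rw [hδ]; linarith
    have : 3 * δ ^ 2 / (4 * (t ^ 2 + δ ^ 2) ^ 2) ≤ 1 / (8 * (t ^ 2 + δ ^ 2)) := by
      rw [div_le_div_iff₀ (by positivity) (by positivity)]
      nlinarith [mul_nonneg hS.le (show 0 ≤ t^2 - 9 * δ^2 by linarith), mul_nonneg hS.le (sq_nonneg δ)]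
    have h4 : 1 / (4 * (t ^ 2 + δ ^ 2)) = 2 * (1 / (8 * (t ^ 2 + δ ^ 2))) := by field_simp; norm_num
    linarith

lemma hardy_y (y1 y2 C0 : ℝ) (h12 : y1 < y2) (hC0 : 0 ≤ C0) :
    ∃ (z : ℝ → ℝ) (c3 C4 : ℝ), ContDiff ℝ 1 z ∧ 0 < c3 ∧ 0 ≤ C4 ∧
    ∀ y c, 0 < y → y < 2 * π → (y ≤ y2 → -C0 ≤ c) → (y1 ≤ y → c ≤ C0) →
      c3 - C4 ≤ deriv z y + 2 * z y * c - z y ^ 2 ∧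
      (¬ (y1 ≤ y ∧ y ≤ y2) → c3 ≤ deriv z y + 2 * z y * c - z y ^ 2) := by
  set L := 2 * C0 + 2 with hL
  have hL0 : 0 < L := by positivity
  set ε := Real.exp (-(2 * π * L)) with hε
  have hε0 : 0 < ε := Real.exp_pos _
  have hε1 : ε ≤ 1 := by rw [hε]; apply Real.exp_le_one_iff.2; have := Real.pi_pos; nlinarith [mul_pos this hL0]
  set θ : ℝ → ℝ := fun y => Real.smoothTransition ((y - y1) / (y2 - y1)) with hθ
  have hθC : ContDiff ℝ 1 θ := Real.smoothTransition.contDiff.comp (by fun_prop)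
  set z : ℝ → ℝ := fun y => ε * ((1 - θ y) * Real.exp (L * y) - θ y * Real.exp (-(L * y))) with hz
  have hzC : ContDiff ℝ 1 z := by
    have : ContDiff ℝ 1 (fun y : ℝ => Real.exp (L * y)) := by fun_prop
    have : ContDiff ℝ 1 (fun y : ℝ => Real.exp (-(L * y))) := by fun_prop
    rw [hz]; fun_prop
  have hzd : Continuous (deriv z) := hzC.continuous_deriv le_rfl
  obtain ⟨K, hK⟩ := (isCompact_Icc (a := y1) (b := y2)).exists_bound_of_continuousOn
    (f := fun y => |deriv z y| + 2 * |z y| * C0 + z y ^ 2)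
    (by have := hzC.continuous; fun_prop)
  have key : ∀ y c, 0 < y → y < 2 * π → (y ≤ y2 → -C0 ≤ c) → (y1 ≤ y → c ≤ C0) →
      ¬ (y1 ≤ y ∧ y ≤ y2) → ε ^ 2 ≤ deriv z y + 2 * z y * c - z y ^ 2 := by
    intro y c hy0 hy2 hcl hcu hn
    by_cases hy : y < y1
    · have hev : z =ᶠ[nhds y] fun y => ε * Real.exp (L * y) := by
        filter_upwards [Iio_mem_nhds hy] with s hs
        have : θ s = 0 := by
          apply Real.smoothTransition.zero_of_nonpos
          apply div_nonpos_of_nonpos_of_nonneg <;> simp at hs <;> linarith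
        simp [hz, this]
      have hder : deriv z y = ε * (Real.exp (L * y) * L) := by
        rw [hev.deriv_eq]
        have h1 : HasDerivAt (fun y : ℝ => L * y) L y := by simpa using (hasDerivAt_id y).const_mul L
        exact (h1.exp.const_mul ε).deriv
      rw [hder, hev.eq_of_nhds]
      have hc := hcl (by linarith)
      have hE1 : 1 ≤ Real.exp (L * y) := Real.one_le_exp (by positivity)
      have hE2 : ε * Real.exp (L * y) ≤ 1 := by
        rw [hε, ← Real.exp_add]; apply Real.exp_le_one_iff.2; nlinarith
      set V := ε * Real.exp (L * y) with hV
      have hV0 : ε ≤ V := by nlinarith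
      have : ε * (Real.exp (L * y) * L) = V * L := by rw [hV]; ring
      rw [this]
      nlinarith
    · have hy' : y2 < y := by by_contra hh; exact hn ⟨by linarith, by linarith⟩
      have hev : z =ᶠ[nhds y] fun y => -ε * Real.exp (-(L * y)) := by
        filter_upwards [Ioi_mem_nhds hy'] with s hs
        have : θ s = 1 := by
          apply Real.smoothTransition.one_of_one_le
          rw [one_le_div (by linarith)]; simp at hs; linarith
        simp [hz, this]
      have hder : deriv z y = -ε * (Real.exp (-(L * y)) * (-L)) := by
        rw [hev.deriv_eq]
        have h1 : HasDerivAt (fun y : ℝ => -(L * y)) (-L) y := by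
          have := ((hasDerivAt_id y).const_mul L).neg
          rw [mul_one] at this
          exact this
        exact (h1.exp.const_mul (-ε)).deriv
      rw [hder, hev.eq_of_nhds]
      have hc := hcu (by linarith)
      have hE1 : Real.exp (-(L * y)) ≤ 1 := Real.exp_le_one_iff.2 (by nlinarith)
      have hE2 : ε ≤ Real.exp (-(L * y)) := by
        rw [hε]; apply Real.exp_le_exp.2; nlinarith
      set V := Real.exp (-(L * y)) with hV
      have hV0 : 0 < V := Real.exp_pos _
      have hA : ε * V ≤ 1 := by nlinarith
      have hB : 0 < ε * V := by positivity
      have : -ε * (V * (-L)) + 2 * (-ε * V) * c - (-ε * V) ^ 2 = (ε * V) * (L - 2 * c - ε * V) := by ring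
      rw [this]
      calc ε ^ 2 ≤ (ε * V) * 1 := by nlinarith
        _ ≤ _ := by gcongr; linarith
  refine ⟨z, ε ^ 2, ε ^ 2 + |K|, hzC, by positivity, by positivity, ?_⟩
  intro y c hy0 hy2 hcl hcu
  refine ⟨?_, key y c hy0 hy2 hcl hcu⟩
  by_cases hJ : y1 ≤ y ∧ y ≤ y2
  · have h1 := hK y ⟨hJ.1, hJ.2⟩
    have h2 := (le_abs_self _).trans h1
    have h3 : |2 * z y * c| ≤ 2 * |z y| * C0 := by
      rw [abs_mul, abs_mul]; norm_num
      gcongr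
      exact abs_le.2 ⟨hcl hJ.2, hcu hJ.1⟩
    have := neg_abs_le (2 * z y * c)
    have := neg_abs_le (deriv z y)
    have := le_abs_self K
    linarith
  · have := key y c hy0 hy2 hcl hcu hJ
    have := abs_nonneg K
    have := sq_nonneg ε
    linarith


noncomputable def pdx (F : ℝ × ℝ → ℝ) (p : ℝ × ℝ) : ℝ := fderiv ℝ F p (1, 0)
noncomputable def pdy (F : ℝ × ℝ → ℝ) (p : ℝ × ℝ) : ℝ := fderiv ℝ F p (0, 1)

lemma lineX {E : Type*} [NormedAddCommGroup E] [NormedSpace ℝ E] {F : ℝ × ℝ → E} {p : ℝ × ℝ}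
    (hF : DifferentiableAt ℝ F p) :
    HasDerivAt (fun t => F (t, p.2)) (fderiv ℝ F p (1, 0)) p.1 := by
  have h : HasDerivAt (fun t : ℝ => (t, p.2)) ((1 : ℝ), (0 : ℝ)) p.1 :=
    (hasDerivAt_id p.1).prodMk (hasDerivAt_const p.1 p.2)
  exact HasFDerivAt.comp_hasDerivAt (f := fun t : ℝ => (t, p.2)) p.1 (hF.hasFDerivAt) h

lemma lineY {E : Type*} [NormedAddCommGroup E] [NormedSpace ℝ E] {F : ℝ × ℝ → E} {p : ℝ × ℝ}
    (hF : DifferentiableAt ℝ F p) :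
    HasDerivAt (fun t => F (p.1, t)) (fderiv ℝ F p (0, 1)) p.2 := by
  have h : HasDerivAt (fun t : ℝ => (p.1, t)) ((0 : ℝ), (1 : ℝ)) p.2 :=
    (hasDerivAt_const p.2 p.1).prodMk (hasDerivAt_id p.2)
  exact HasFDerivAt.comp_hasDerivAt (f := fun t : ℝ => (p.1, t)) p.2 (hF.hasFDerivAt) h

lemma pdx_eq {F : ℝ × ℝ → ℝ} {p : ℝ × ℝ} {d : ℝ} (hF : DifferentiableAt ℝ F p)
    (h : HasDerivAt (fun t => F (t, p.2)) d p.1) : pdx F p = d := (lineX hF).unique h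

lemma pdy_eq {F : ℝ × ℝ → ℝ} {p : ℝ × ℝ} {d : ℝ} (hF : DifferentiableAt ℝ F p)
    (h : HasDerivAt (fun t => F (p.1, t)) d p.2) : pdy F p = d := (lineY hF).unique h

lemma cont_fderiv_apply {F : ℝ × ℝ → ℝ} (hF : ContDiff ℝ 1 F) (h : ℝ × ℝ) :
    Continuous (fun p => fderiv ℝ F p h) :=
  (hF.continuous_fderiv (by norm_num)).clm_apply continuous_const

lemma integrable_fderiv_apply {F : ℝ × ℝ → ℝ} (hF : ContDiff ℝ 1 F) (hc : HasCompactSupport F)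
    (h : ℝ × ℝ) : Integrable (fun p => fderiv ℝ F p h) := by
  refine (cont_fderiv_apply hF h).integrable_of_hasCompactSupport ?_
  refine (hc.fderiv (𝕜 := ℝ)).mono fun p hp => ?_
  intro h0
  exact hp (by simp [h0])

lemma null_dx {F : ℝ × ℝ → ℝ} (hF : ContDiff ℝ 1 F) (hc : HasCompactSupport F) :
    Integrable (pdx F) ∧ ∫ p, pdx F p = 0 := by
  have hI := integrable_fderiv_apply hF hc (1, 0)
  refine ⟨hI, ?_⟩
  have hI' := hI
  have hF' := hF.continuous.integrable_of_hasCompactSupport (μ := volume) hc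
  rw [Measure.volume_eq_prod] at hI hF' ⊢
  simp only [pdx]
  rw [integral_prod_symm _ hI]
  rw [integral_eq_zero_of_ae]
  filter_upwards [hI.prod_left_ae, hF'.prod_left_ae] with y h1 h2
  exact integral_eq_zero_of_hasDerivAt_of_integrable
    (fun x => lineX (p := (x, y)) (hF.differentiable (by norm_num) _)) h1 h2

lemma null_dy {F : ℝ × ℝ → ℝ} (hF : ContDiff ℝ 1 F) (hc : HasCompactSupport F) :
    Integrable (pdy F) ∧ ∫ p, pdy F p = 0 := by
  have hI := integrable_fderiv_apply hF hc (0, 1)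
  refine ⟨hI, ?_⟩
  have hI' := hI
  have hF' := hF.continuous.integrable_of_hasCompactSupport (μ := volume) hc
  rw [Measure.volume_eq_prod] at hI hF' ⊢
  simp only [pdy]
  rw [integral_prod _ hI]
  rw [integral_eq_zero_of_ae]
  filter_upwards [hI.prod_right_ae, hF'.prod_right_ae] with x h1 h2
  exact integral_eq_zero_of_hasDerivAt_of_integrable
    (fun y => lineY (p := (x, y)) (hF.differentiable (by norm_num) _)) h1 h2

lemma pd_zero {F : ℝ × ℝ → ℝ} {S : Set (ℝ × ℝ)} (hS : IsClosed S) (hF : ∀ p, p ∉ S → F p = 0)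
    {p : ℝ × ℝ} (hp : p ∉ S) : pdx F p = 0 ∧ pdy F p = 0 := by
  have h : F =ᶠ[nhds p] fun _ => 0 := by
    filter_upwards [hS.isOpen_compl.mem_nhds hp] with q hq using hF q hq
  simp [pdx, pdy, h.fderiv_eq]

lemma contDiff_pdx {F : ℝ × ℝ → ℝ} (hF : ContDiff ℝ 2 F) : ContDiff ℝ 1 (pdx F) :=
  (hF.fderiv_right (m := 1) (by norm_num)).clm_apply contDiff_const

lemma contDiff_pdy {F : ℝ × ℝ → ℝ} (hF : ContDiff ℝ 2 F) : ContDiff ℝ 1 (pdy F) :=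
  (hF.fderiv_right (m := 1) (by norm_num)).clm_apply contDiff_const

lemma pd_symm {F : ℝ × ℝ → ℝ} (hF : ContDiff ℝ 2 F) (p : ℝ × ℝ) :
    pdx (pdy F) p = pdy (pdx F) p := by
  have hs : IsSymmSndFDerivAt ℝ F p := (hF.contDiffAt).isSymmSndFDerivAt (by simp)
  have hd : DifferentiableAt ℝ (fderiv ℝ F) p :=
    (hF.fderiv_right (m := 1) (by norm_num)).differentiable (by norm_num) p
  have h1 : ∀ h : ℝ × ℝ, ∀ k, fderiv ℝ (fun q => fderiv ℝ F q h) p k = fderiv ℝ (fderiv ℝ F) p k h := by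
    intro h k
    rw [fderiv_clm_apply hd (differentiableAt_const h)]
    simp
  have e1 : pdx (pdy F) p = fderiv ℝ (fderiv ℝ F) p (1, 0) (0, 1) := h1 _ _
  have e2 : pdy (pdx F) p = fderiv ℝ (fderiv ℝ F) p (0, 1) (1, 0) := h1 _ _
  rw [e1, e2]; exact hs _ _

lemma core (a₁ a₂ B u v : ℝ × ℝ → ℝ) (w z e g : ℝ → ℝ) (S : Set (ℝ × ℝ))
    (ha₁ : ContDiff ℝ 1 a₁) (ha₂ : ContDiff ℝ 1 a₂) (hB : ContDiff ℝ 1 B)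
    (hu : ContDiff ℝ 2 u) (hv : ContDiff ℝ 2 v) (hw : ContDiff ℝ 1 w) (hz : ContDiff ℝ 1 z)
    (he : ContDiff ℝ 1 e) (hg : ContDiff ℝ 1 g) (hS : IsCompact S)
    (huS : ∀ p, p ∉ S → u p = 0) (hvS : ∀ p, p ∉ S → v p = 0)
    (hsin : ∀ p ∈ S, Real.sin (g p.1 * p.2) ≠ 0)
    (k1 k2 k3 : ℝ)
    (hpt : ∀ p ∈ S, ∀ c, c = g p.1 * (Real.cos (g p.1 * p.2) / Real.sin (g p.1 * p.2)) →
      (((-(g p.1 ^ 2 + c ^ 2)) * (u p ^ 2 + v p ^ 2) + c * (2 * (u p * pdy u p + v p * pdy v p)))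
        - k1 * (deriv w p.1 * (u p ^ 2 + v p ^ 2) + w p.1 * (2 * (u p * pdx u p + v p * pdx v p)))
        - k2 * (e p.1 * (deriv z p.2 * (u p ^ 2 + v p ^ 2) + z p.2 * (2 * (u p * pdy u p + v p * pdy v p))))
        + k3 * ((pdy B p * (a₁ p * (u p ^ 2 + v p ^ 2) - u p * pdx v p + v p * pdx u p)
              + B p * (pdy a₁ p * (u p ^ 2 + v p ^ 2) + a₁ p * (2 * (u p * pdy u p + v p * pdy v p))
                - pdy u p * pdx v p - u p * pdx (pdy v) p + pdy v p * pdx u p + v p * pdx (pdy u) p))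
            - (pdx B p * (a₂ p * (u p ^ 2 + v p ^ 2) - u p * pdy v p + v p * pdy u p)
              + B p * (pdx a₂ p * (u p ^ 2 + v p ^ 2) + a₂ p * (2 * (u p * pdx u p + v p * pdx v p))
                - pdx u p * pdy v p - u p * pdx (pdy v) p + pdx v p * pdy u p + v p * pdx (pdy u) p))))
      ≤ (a₁ p * u p - pdx v p) ^ 2 + (pdx u p + a₁ p * v p) ^ 2 + (a₂ p * u p - pdy v p) ^ 2
        + (pdy u p + a₂ p * v p) ^ 2 - (u p ^ 2 + v p ^ 2)) :
    Integrable (fun p => u p ^ 2 + v p ^ 2) ∧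
    Integrable (fun p => (a₁ p * u p - pdx v p) ^ 2 + (pdx u p + a₁ p * v p) ^ 2
      + ((a₂ p * u p - pdy v p) ^ 2 + (pdy u p + a₂ p * v p) ^ 2)) ∧
    ∫ p, (u p ^ 2 + v p ^ 2) ≤ ∫ p, ((a₁ p * u p - pdx v p) ^ 2 + (pdx u p + a₁ p * v p) ^ 2
      + ((a₂ p * u p - pdy v p) ^ 2 + (pdy u p + a₂ p * v p) ^ 2)) := by
  have hux := contDiff_pdx hu
  have huy := contDiff_pdy hu
  have hvx := contDiff_pdx hv
  have hvy := contDiff_pdy hv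
  have hu1 : ContDiff ℝ 1 u := hu.of_le (by norm_num)
  have hv1 : ContDiff ℝ 1 v := hv.of_le (by norm_num)
  set F1 : ℝ × ℝ → ℝ := fun p => w p.1 * (u p ^ 2 + v p ^ 2) with hF1
  set F2 : ℝ × ℝ → ℝ := fun p => e p.1 * (z p.2 * (u p ^ 2 + v p ^ 2)) with hF2
  set F3 : ℝ × ℝ → ℝ := fun p => B p * (a₂ p * (u p ^ 2 + v p ^ 2) - u p * pdy v p + v p * pdy u p) with hF3
  set F4 : ℝ × ℝ → ℝ := fun p => B p * (a₁ p * (u p ^ 2 + v p ^ 2) - u p * pdx v p + v p * pdx u p) with hF4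
  set F5 : ℝ × ℝ → ℝ := fun p => (g p.1 * (Real.cos (g p.1 * p.2) / Real.sin (g p.1 * p.2))) * (u p ^ 2 + v p ^ 2) with hF5
  have S1 : ∀ p, p ∉ S → F1 p = 0 := fun p hp => by simp [hF1, huS p hp, hvS p hp]
  have S2 : ∀ p, p ∉ S → F2 p = 0 := fun p hp => by simp [hF2, huS p hp, hvS p hp]
  have S3 : ∀ p, p ∉ S → F3 p = 0 := fun p hp => by simp [hF3, huS p hp, hvS p hp]
  have S4 : ∀ p, p ∉ S → F4 p = 0 := fun p hp => by simp [hF4, huS p hp, hvS p hp]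
  have S5 : ∀ p, p ∉ S → F5 p = 0 := fun p hp => by simp [hF5, huS p hp, hvS p hp]
  have hw' : ContDiff ℝ 1 (fun p : ℝ × ℝ => w p.1) := hw.comp contDiff_fst
  have he' : ContDiff ℝ 1 (fun p : ℝ × ℝ => e p.1) := he.comp contDiff_fst
  have hz' : ContDiff ℝ 1 (fun p : ℝ × ℝ => z p.2) := hz.comp contDiff_snd
  have hg' : ContDiff ℝ 1 (fun p : ℝ × ℝ => g p.1) := hg.comp contDiff_fst
  have D1 : ContDiff ℝ 1 F1 := by rw [hF1]; fun_prop
  have D2 : ContDiff ℝ 1 F2 := by rw [hF2]; fun_prop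
  have D3 : ContDiff ℝ 1 F3 := by rw [hF3]; fun_prop
  have D4 : ContDiff ℝ 1 F4 := by rw [hF4]; fun_prop
  have D5 : ContDiff ℝ 1 F5 := by
    rw [contDiff_iff_contDiffAt]
    intro p
    by_cases hp : p ∈ S
    · have hs := hsin p hp
      have hgy : ContDiff ℝ 1 (fun p : ℝ × ℝ => g p.1 * p.2) := by fun_prop
      have q1 : ContDiffAt ℝ 1 (fun p : ℝ × ℝ => Real.cos (g p.1 * p.2) / Real.sin (g p.1 * p.2)) p :=
        ContDiffAt.div (hgy.cos.contDiffAt) (hgy.sin.contDiffAt) hs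
      exact (hg'.contDiffAt.mul q1).mul ((hu1.pow 2).add (hv1.pow 2)).contDiffAt
    · have h : F5 =ᶠ[nhds p] fun _ => 0 := by
        filter_upwards [hS.isClosed.isOpen_compl.mem_nhds hp] with q hq using S5 q hq
      exact contDiffAt_const.congr_of_eventuallyEq h
  have N1 := null_dx D1 (HasCompactSupport.intro hS S1)
  have N2 := null_dy D2 (HasCompactSupport.intro hS S2)
  have N3 := null_dx D3 (HasCompactSupport.intro hS S3)
  have N4 := null_dy D4 (HasCompactSupport.intro hS S4)
  have N5 := null_dy D5 (HasCompactSupport.intro hS S5)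
  have Z : ∀ p, p ∉ S → pdx u p = 0 ∧ pdy u p = 0 ∧ pdx v p = 0 ∧ pdy v p = 0 := fun p hp =>
    ⟨(pd_zero hS.isClosed huS hp).1, (pd_zero hS.isClosed huS hp).2,
      (pd_zero hS.isClosed hvS hp).1, (pd_zero hS.isClosed hvS hp).2⟩
  have Iρ : Integrable (fun p => u p ^ 2 + v p ^ 2) := by
    refine Continuous.integrable_of_hasCompactSupport ?_ (HasCompactSupport.intro hS ?_)
    · exact ((hu1.pow 2).add (hv1.pow 2)).continuous
    · intro p hp; simp [huS p hp, hvS p hp]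
  have IQ : Integrable (fun p => (a₁ p * u p - pdx v p) ^ 2 + (pdx u p + a₁ p * v p) ^ 2
      + ((a₂ p * u p - pdy v p) ^ 2 + (pdy u p + a₂ p * v p) ^ 2)) := by
    refine Continuous.integrable_of_hasCompactSupport ?_ (HasCompactSupport.intro hS ?_)
    · have := hux.continuous
      have := huy.continuous
      have := hvx.continuous
      have := hvy.continuous
      have := hu1.continuous
      have := hv1.continuous
      have := ha₁.continuous
      have := ha₂.continuous
      fun_prop
    · intro p hp; simp [huS p hp, hvS p hp, Z p hp]
  refine ⟨Iρ, IQ, ?_⟩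
  have hmono : ∫ p, (pdy F5 p - k1 * pdx F1 p - k2 * pdy F2 p + k3 * (pdy F4 p - pdx F3 p))
      ≤ ∫ p, (((a₁ p * u p - pdx v p) ^ 2 + (pdx u p + a₁ p * v p) ^ 2
      + ((a₂ p * u p - pdy v p) ^ 2 + (pdy u p + a₂ p * v p) ^ 2)) - (u p ^ 2 + v p ^ 2)) := by
    refine integral_mono (((N5.1.sub (N1.1.const_mul k1)).sub (N2.1.const_mul k2)).add
      ((N4.1.sub N3.1).const_mul k3)) (IQ.sub Iρ) ?_
    intro p
    by_cases hp : p ∈ S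
    · have df : ∀ {F : ℝ × ℝ → ℝ}, ContDiff ℝ 1 F → DifferentiableAt ℝ F p :=
        fun h => h.differentiable (by norm_num) p
      have X : ∀ {F : ℝ × ℝ → ℝ}, ContDiff ℝ 1 F → HasDerivAt (fun t => F (t, p.2)) (pdx F p) p.1 :=
        fun h => lineX (df h)
      have Y : ∀ {F : ℝ × ℝ → ℝ}, ContDiff ℝ 1 F → HasDerivAt (fun t => F (p.1, t)) (pdy F p) p.2 :=
        fun h => lineY (df h)
      have ρx : HasDerivAt (fun t => u (t, p.2) ^ 2 + v (t, p.2) ^ 2)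
          (2 * (u p * pdx u p + v p * pdx v p)) p.1 := by
        refine (((X hu1).pow 2).add ((X hv1).pow 2)).congr_deriv ?_
        norm_num; ring
      have ρy : HasDerivAt (fun t => u (p.1, t) ^ 2 + v (p.1, t) ^ 2)
          (2 * (u p * pdy u p + v p * pdy v p)) p.2 := by
        refine (((Y hu1).pow 2).add ((Y hv1).pow 2)).congr_deriv ?_
        norm_num; ring
      have E1 : pdx F1 p = deriv w p.1 * (u p ^ 2 + v p ^ 2) + w p.1 * (2 * (u p * pdx u p + v p * pdx v p)) :=
        pdx_eq (df D1) (((hw.differentiable (by norm_num) p.1).hasDerivAt).mul ρx)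
      have E2 : pdy F2 p = e p.1 * (deriv z p.2 * (u p ^ 2 + v p ^ 2)
          + z p.2 * (2 * (u p * pdy u p + v p * pdy v p))) :=
        pdy_eq (df D2) ((((hz.differentiable (by norm_num) p.2).hasDerivAt).mul ρy).const_mul (e p.1))
      have E3 : pdx F3 p = (pdx B p * (a₂ p * (u p ^ 2 + v p ^ 2) - u p * pdy v p + v p * pdy u p)
              + B p * (pdx a₂ p * (u p ^ 2 + v p ^ 2) + a₂ p * (2 * (u p * pdx u p + v p * pdx v p))
                - pdx u p * pdy v p - u p * pdx (pdy v) p + pdx v p * pdy u p + v p * pdx (pdy u) p)) := by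
        refine pdx_eq (df D3) (((X hB).mul ((((X ha₂).mul ρx).sub ((X hu1).mul (X hvy))).add
          ((X hv1).mul (X huy)))).congr_deriv ?_)
        simp only [Pi.mul_apply, Pi.add_apply, Pi.sub_apply]
        ring
      have E4 : pdy F4 p = (pdy B p * (a₁ p * (u p ^ 2 + v p ^ 2) - u p * pdx v p + v p * pdx u p)
              + B p * (pdy a₁ p * (u p ^ 2 + v p ^ 2) + a₁ p * (2 * (u p * pdy u p + v p * pdy v p))
                - pdy u p * pdx v p - u p * pdx (pdy v) p + pdy v p * pdx u p + v p * pdx (pdy u) p)) := by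
        rw [pd_symm hu, pd_symm hv]
        refine pdy_eq (df D4) (((Y hB).mul ((((Y ha₁).mul ρy).sub ((Y hu1).mul (Y hvx))).add
          ((Y hv1).mul (Y hux)))).congr_deriv ?_)
        simp only [Pi.mul_apply, Pi.add_apply, Pi.sub_apply]
        ring
      have hs := hsin p hp
      obtain ⟨c, hc⟩ : ∃ c, c = g p.1 * (Real.cos (g p.1 * p.2) / Real.sin (g p.1 * p.2)) := ⟨_, rfl⟩
      have E5 : pdy F5 p = ((-(g p.1 ^ 2 + c ^ 2)) * (u p ^ 2 + v p ^ 2) + c * (2 * (u p * pdy u p + v p * pdy v p))) := by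
        have l : HasDerivAt (fun t : ℝ => g p.1 * t) (g p.1) p.2 := by
          simpa using (hasDerivAt_id p.2).const_mul (g p.1)
        have q : HasDerivAt (fun t : ℝ => g p.1 * (Real.cos (g p.1 * t) / Real.sin (g p.1 * t)))
            (-(g p.1 ^ 2 + c ^ 2)) p.2 := by
          refine ((l.cos.div l.sin hs).const_mul (g p.1)).congr_deriv ?_
          rw [hc]
          field_simp
          ring
        rw [show c = g p.1 * (Real.cos (g p.1 * p.2) / Real.sin (g p.1 * p.2)) from hc] at q ⊢
        exact pdy_eq (df D5) (q.mul ρy)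
      have := hpt p hp c hc
      simp only [E1, E2, E3, E4, E5]
      linarith
    · have := Z p hp
      simp [pd_zero hS.isClosed S1 hp, pd_zero hS.isClosed S2 hp, pd_zero hS.isClosed S3 hp,
        pd_zero hS.isClosed S4 hp, pd_zero hS.isClosed S5 hp, this, huS p hp, hvS p hp]
  have i1 := N1.1.const_mul k1
  have i2 := N2.1.const_mul k2
  have i3 := (N4.1.sub N3.1).const_mul k3
  have hzero : ∫ p, (pdy F5 p - k1 * pdx F1 p - k2 * pdy F2 p + k3 * (pdy F4 p - pdx F3 p)) = 0 := by
    have s1 := integral_add ((N5.1.sub i1).sub i2) i3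
    have s2 := integral_sub (N5.1.sub i1) i2
    have s3 := integral_sub N5.1 i1
    have s4 := integral_sub N4.1 N3.1
    simp only [Pi.sub_apply] at s1 s2 s3 s4
    rw [s1, s2, s3, integral_const_mul, integral_const_mul, integral_const_mul, s4, N1.2, N2.2, N3.2, N4.2, N5.2]
    simp
  rw [hzero, integral_sub IQ Iρ] at hmono
  linarith

lemma cot_bounds (b0 b1 g y : ℝ) (hb0 : 0 < b0) (hb0' : b0 < π) (hb1 : 0 < b1) (hb1' : b1 < π)
    (hg : 1 / 2 ≤ g) (hg1 : g ≤ 1) (hy : 0 < y) (hgy : g * y < π) :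
    (y ≤ b1 → -(1 / Real.sin b1 + 1 / Real.sin (b0 / 2)) ≤ g * (Real.cos (g * y) / Real.sin (g * y))) ∧
    (b0 ≤ y → g * (Real.cos (g * y) / Real.sin (g * y)) ≤ 1 / Real.sin b1 + 1 / Real.sin (b0 / 2)) := by
  have hgy0 : 0 < g * y := by positivity
  have hs := Real.sin_pos_of_pos_of_lt_pi hgy0 hgy
  have hs1 := Real.sin_pos_of_pos_of_lt_pi hb1 hb1'
  have hs0 := Real.sin_pos_of_pos_of_lt_pi (show 0 < b0 / 2 by linarith) (by linarith)
  have i1 : 0 < 1 / Real.sin b1 := by positivity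
  have i0 : 0 < 1 / Real.sin (b0 / 2) := by positivity
  have hga : 0 ≤ g := by linarith
  constructor
  · intro hyb
    by_cases hc : 0 ≤ Real.cos (g * y)
    · have : 0 ≤ g * (Real.cos (g * y) / Real.sin (g * y)) := by positivity
      linarith
    · push Not at hc
      have h2 : π / 2 < g * y := by
        by_contra hh; push Not at hh
        exact absurd (Real.cos_nonneg_of_mem_Icc ⟨by linarith, hh⟩) (not_le.2 hc)
      have h3 : g * y ≤ b1 := by nlinarith
      have h4 : Real.sin b1 ≤ Real.sin (g * y) := by
        rw [← Real.sin_pi_sub b1, ← Real.sin_pi_sub (g * y)]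
        apply Real.sin_le_sin_of_le_of_le_pi_div_two <;> linarith
      have h5 : -(g * (Real.cos (g * y) / Real.sin (g * y))) ≤ 1 / Real.sin b1 := by
        calc -(g * (Real.cos (g * y) / Real.sin (g * y)))
            = (g * (-Real.cos (g * y))) / Real.sin (g * y) := by ring
          _ ≤ 1 / Real.sin (g * y) := by
              gcongr
              have := Real.neg_one_le_cos (g * y)
              nlinarith
          _ ≤ 1 / Real.sin b1 := one_div_le_one_div_of_le hs1 h4
      linarith
  · intro hyb
    by_cases hc : Real.cos (g * y) ≤ 0
    · have : g * (Real.cos (g * y) / Real.sin (g * y)) ≤ 0 :=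
        mul_nonpos_of_nonneg_of_nonpos hga (div_nonpos_of_nonpos_of_nonneg hc hs.le)
      linarith
    · push Not at hc
      have h2 : g * y < π / 2 := by
        by_contra hh; push Not at hh
        exact absurd (Real.cos_nonpos_of_pi_div_two_le_of_le hh (by linarith)) (not_le.2 hc)
      have h3 : b0 / 2 ≤ g * y := by nlinarith
      have h4 : Real.sin (b0 / 2) ≤ Real.sin (g * y) := by
        apply Real.sin_le_sin_of_le_of_le_pi_div_two <;> linarith
      have h5 : (g * (Real.cos (g * y) / Real.sin (g * y))) ≤ 1 / Real.sin (b0 / 2) := by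
        calc (g * (Real.cos (g * y) / Real.sin (g * y)))
            = (g * (Real.cos (g * y))) / Real.sin (g * y) := by ring
          _ ≤ 1 / Real.sin (g * y) := by
              gcongr
              have := Real.cos_le_one (g * y)
              nlinarith
          _ ≤ 1 / Real.sin (b0 / 2) := one_div_le_one_div_of_le hs0 h4
      linarith

/-- translation of complex quantities to real ones -/
lemma re_im_deriv {ψ : ℝ × ℝ → ℂ} (hψ : Differentiable ℝ ψ) (p h : ℝ × ℝ) :
    fderiv ℝ (fun q => (ψ q).re) p h = (fderiv ℝ ψ p h).re ∧
    fderiv ℝ (fun q => (ψ q).im) p h = (fderiv ℝ ψ p h).im := by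
  constructor
  · have := (Complex.reCLM.hasFDerivAt.comp p (hψ p).hasFDerivAt).fderiv
    have h2 : fderiv ℝ (fun q => (ψ q).re) p = Complex.reCLM.comp (fderiv ℝ ψ p) := this
    rw [h2]; rfl
  · have := (Complex.imCLM.hasFDerivAt.comp p (hψ p).hasFDerivAt).fderiv
    have h2 : fderiv ℝ (fun q => (ψ q).im) p = Complex.imCLM.comp (fderiv ℝ ψ p) := this
    rw [h2]; rfl

lemma norm_sq_aux (d s : ℂ) (a : ℝ) :
    ‖Complex.I * d + (a : ℂ) * s‖ ^ 2 = (a * s.re - d.im) ^ 2 + (d.re + a * s.im) ^ 2 := by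
  rw [Complex.sq_norm, Complex.normSq_apply]
  simp
  ring

lemma iter_integral (h : ℝ → ℝ) (F : ℝ × ℝ → ℝ) (hF : Integrable F)
    (h0 : ∀ p : ℝ × ℝ, ¬ (0 < p.2 ∧ p.2 < h p.1) → F p = 0) :
    ∫ x : ℝ, ∫ y in Set.Ioo 0 (h x), F (x, y) = ∫ p, F p := by
  rw [Measure.volume_eq_prod] at hF ⊢
  rw [integral_prod _ hF]
  congr 1; ext x
  apply setIntegral_eq_integral_of_forall_compl_eq_zero
  intro y hy
  exact h0 (x, y) hy

/-- Absence of discrete spectrum below the threshold `1` for the magnetic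
Dirichlet Laplacian on a deformed strip, in quadratic-form formulation. -/
theorem magnetic_form_no_spectrum_below_one
    (a₁ a₂ : ℝ × ℝ → ℝ)
    (ha₁ : ContDiff ℝ 1 a₁) (ha₂ : ContDiff ℝ 1 a₂)
    (hAbound : ∃ M : ℝ, ∀ p : ℝ × ℝ, |a₁ p| ≤ M ∧ |a₂ p| ≤ M)
    (B : ℝ × ℝ → ℝ)
    (hBdef : ∀ p : ℝ × ℝ,
      B p = deriv (fun t => a₂ (t, p.2)) p.1 - deriv (fun t => a₁ (p.1, t)) p.2)
    (hB : ContDiff ℝ 1 B)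
    (hBsupp : HasCompactSupport B)
    (hBin : tsupport B ⊆ {p : ℝ × ℝ | 0 < p.2 ∧ p.2 < π})
    (hBne : ∃ p : ℝ × ℝ, B p ≠ 0) :
    ∃ α₀ : ℝ, 0 < α₀ ∧
      ∀ (α : ℝ) (f : ℝ → ℝ), 0 < α → α < α₀ →
        (∀ x, 0 ≤ f x) → ContDiff ℝ 3 f →
        (∀ x, |f x| ≤ α / (1 + x ^ 2)) →
        (∀ x, |deriv f x| ≤ α / (1 + x ^ 2)) →
        (∀ x, |deriv (deriv f) x| ≤ α / (1 + x ^ 2)) →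
        (∀ x, |deriv (deriv (deriv f)) x| ≤ α / (1 + x ^ 2)) →
        ∀ ψ : ℝ × ℝ → ℂ, ContDiff ℝ (⊤ : ℕ∞) ψ → HasCompactSupport ψ →
          tsupport ψ ⊆ {p : ℝ × ℝ | 0 < p.2 ∧ p.2 < π * (1 + f p.1)} →
          (∫ x : ℝ, ∫ y in Set.Ioo 0 (π * (1 + f x)),
              (‖Complex.I * deriv (fun t => ψ (t, y)) x + (a₁ (x, y) : ℂ) * ψ (x, y)‖ ^ 2
                + ‖Complex.I * deriv (fun t => ψ (x, t)) y + (a₂ (x, y) : ℂ) * ψ (x, y)‖ ^ 2))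
            ≥ ∫ x : ℝ, ∫ y in Set.Ioo 0 (π * (1 + f x)), ‖ψ (x, y)‖ ^ 2 := by
  obtain ⟨p0, hp0⟩ := hBne
  have hp0T : p0 ∈ tsupport B := subset_tsupport B hp0
  have hcpt : IsCompact (tsupport B) := hBsupp
  have hne : (tsupport B).Nonempty := ⟨p0, hp0T⟩
  -- vertical extent of the support
  obtain ⟨q0, hq0, hq0min⟩ := hcpt.exists_isMinOn hne continuous_snd.continuousOn
  obtain ⟨q1, hq1, hq1max⟩ := hcpt.exists_isMaxOn hne continuous_snd.continuousOn
  obtain ⟨b0, hb0⟩ : ∃ b, b = q0.2 := ⟨_, rfl⟩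
  obtain ⟨b1, hb1⟩ : ∃ b, b = q1.2 := ⟨_, rfl⟩
  have hb0p : 0 < b0 ∧ b0 < π := by rw [hb0]; exact hBin hq0
  have hb1p : 0 < b1 ∧ b1 < π := by rw [hb1]; exact hBin hq1
  have hbd : ∀ p ∈ tsupport B, b0 ≤ p.2 ∧ p.2 ≤ b1 := by
    intro p hp; rw [hb0, hb1]; exact ⟨hq0min hp, hq1max hp⟩
  obtain ⟨C0, hC0⟩ : ∃ C, C = 1 / Real.sin b1 + 1 / Real.sin (b0 / 2) := ⟨_, rfl⟩
  have hC0n : 0 ≤ C0 := by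
    have hs1 := Real.sin_pos_of_pos_of_lt_pi hb1p.1 hb1p.2
    have hs0 := Real.sin_pos_of_pos_of_lt_pi (show 0 < b0 / 2 by linarith) (by linarith)
    rw [hC0]; positivity
  -- horizontal extent
  obtain ⟨R, hR⟩ := hcpt.exists_bound_of_continuousOn (f := fun p : ℝ × ℝ => p.1) continuous_fst.continuousOn
  obtain ⟨m1, hm1⟩ := hcpt.exists_bound_of_continuousOn (f := B) hB.continuous.continuousOn
  obtain ⟨m2, hm2⟩ := hcpt.exists_bound_of_continuousOn (f := pdx B) (cont_fderiv_apply hB _).continuousOn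
  obtain ⟨m3, hm3⟩ := hcpt.exists_bound_of_continuousOn (f := pdy B) (cont_fderiv_apply hB _).continuousOn
  obtain ⟨m, hm⟩ : ∃ m, m = |m1| + |m2| + |m3| := ⟨_, rfl⟩
  have hmn : 0 ≤ m := by rw [hm]; positivity
  -- a box where B is bounded below
  obtain ⟨β, hβ⟩ : ∃ β, β = B p0 ^ 2 / 2 := ⟨_, rfl⟩
  have hβ0 : 0 < β := by rw [hβ]; positivity
  have hopen : IsOpen {p : ℝ × ℝ | β < B p ^ 2} := isOpen_lt continuous_const (hB.continuous.pow 2)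
  obtain ⟨r0, hr0, hball⟩ := Metric.isOpen_iff.1 hopen p0 (by
    show β < B p0 ^ 2
    linarith)
  obtain ⟨r, hr⟩ : ∃ r, r = r0 / 3 := ⟨_, rfl⟩
  have hrp : 0 < r := by rw [hr]; positivity
  have hbox : ∀ p : ℝ × ℝ, |p.1 - p0.1| < 2 * r → |p.2 - p0.2| ≤ r → β < B p ^ 2 := by
    intro p h1 h2
    apply hball
    rw [Metric.mem_ball, Prod.dist_eq, max_lt_iff, Real.dist_eq, Real.dist_eq]
    constructor <;> linarith
  have hT : ∀ p, β < B p ^ 2 → p ∈ tsupport B := by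
    intro p hp
    apply subset_tsupport
    intro h; rw [h] at hp; norm_num at hp; linarith
  have hy1 : b0 ≤ p0.2 - r := (hbd (p0.1, p0.2 - r) (hT _ (hbox _ (by simp [hrp]) (by simp [abs_of_pos hrp])))).1
  have hy2 : p0.2 + r ≤ b1 := (hbd (p0.1, p0.2 + r) (hT _ (hbox _ (by simp [hrp]) (by simp [abs_of_pos hrp])))).2
  obtain ⟨w, c1, C2, hw, hc1, hC2, hwx⟩ := hardy_x p0.1 r hrp
  obtain ⟨z, c3, C4, hz, hc3, hC4, hzy⟩ := hardy_y (p0.2 - r) (p0.2 + r) C0 (by linarith) hC0n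
  let e : ContDiffBump p0.1 := ⟨r, 2 * r, hrp, by linarith⟩
  have heC : ContDiff ℝ 1 (fun x => e x) := e.contDiff
  obtain ⟨k1, k2, k3, α₀, hα₀, hmain⟩ := alg_main c1 C2 c3 (C4 / β) m C0 (1 / (1 + R ^ 2)) hc1 hC2 hc3
    (by positivity) hmn hC0n (by positivity)
  refine ⟨min 1 α₀, by positivity, ?_⟩
  intro α f hα hαlt hf hfC hf0 _ _ _ ψ hψ hψc hψS
  have hα1 : α ≤ 1 := (hαlt.le).trans (min_le_left _ _)
  have hα2 : α ≤ α₀ := (hαlt.le).trans (min_le_right _ _)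
  have hf1 : ∀ x, f x ≤ α * (1 / (1 + x ^ 2)) := fun x => by
    have := (le_abs_self _).trans (hf0 x)
    rwa [mul_one_div]
  have hf2 : ∀ x, f x ≤ 1 := fun x => by
    have h1 : 1 / (1 + x ^ 2) ≤ 1 := by
      rw [div_le_one (by positivity)]; nlinarith [sq_nonneg x]
    have h2 : 0 < 1 / (1 + x ^ 2) := by positivity
    nlinarith [hf1 x]
  have hfpos : ∀ x, 0 < 1 + f x := fun x => by linarith [hf x]
  obtain ⟨g, hg⟩ : ∃ g : ℝ → ℝ, g = fun x => 1 / (1 + f x) := ⟨_, rfl⟩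
  have hgC : ContDiff ℝ 1 g := by
    rw [hg]
    have hfC1 : ContDiff ℝ 1 f := hfC.of_le (by norm_num)
    exact contDiff_const.div (contDiff_const.add hfC1) (fun x => (hfpos x).ne')
  have hg1 : ∀ x, g x ≤ 1 := fun x => by
    rw [hg]; simp only; rw [div_le_one (hfpos x)]; linarith [hf x]
  have hg2 : ∀ x, 1 / 2 ≤ g x := fun x => by
    rw [hg]; exact one_div_le_one_div_of_le (hfpos x) (by linarith [hf2 x])
  have hg3 : ∀ x, 1 - g x ^ 2 ≤ 2 * f x := fun x => by
    have h1 : g x * (1 + f x) = 1 := by rw [hg]; have := hfpos x; field_simp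
    have h2 : 1 - g x = g x * f x := by linarith
    have h3 : g x * f x ≤ f x := mul_le_of_le_one_left (hf x) (hg1 x)
    nlinarith [hg1 x, hg2 x, hf x]
  have hgy : ∀ p ∈ tsupport ψ, 0 < p.2 ∧ p.2 < 2 * π ∧ g p.1 * p.2 < π := by
    intro p hp
    obtain ⟨h1, h2⟩ := hψS hp
    refine ⟨h1, ?_, ?_⟩
    · nlinarith [hf2 p.1, Real.pi_pos]
    · rw [hg]; simp only; rw [one_div_mul_eq_div, div_lt_iff₀ (hfpos _)]; exact h2
  have hψd : Differentiable ℝ ψ := hψ.differentiable (by simp)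
  obtain ⟨u, hu⟩ : ∃ u : ℝ × ℝ → ℝ, u = fun p => (ψ p).re := ⟨_, rfl⟩
  obtain ⟨v, hv⟩ : ∃ v : ℝ × ℝ → ℝ, v = fun p => (ψ p).im := ⟨_, rfl⟩
  have hψ2 : ContDiff ℝ 2 ψ := contDiff_infty.1 hψ 2
  have huC : ContDiff ℝ 2 u := by rw [hu]; exact Complex.reCLM.contDiff.comp hψ2
  have hvC : ContDiff ℝ 2 v := by rw [hv]; exact Complex.imCLM.contDiff.comp hψ2
  have hψ0 : ∀ p, p ∉ tsupport ψ → ψ p = 0 := fun p hp => image_eq_zero_of_notMem_tsupport hp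
  have hu0 : ∀ p, p ∉ tsupport ψ → u p = 0 := fun p hp => by rw [hu]; simp [hψ0 p hp]
  have hv0 : ∀ p, p ∉ tsupport ψ → v p = 0 := fun p hp => by rw [hv]; simp [hψ0 p hp]
  obtain ⟨I1, I2, hle⟩ := core a₁ a₂ B u v w z (fun x => e x) g (tsupport ψ) ha₁ ha₂ hB huC hvC hw hz heC hgC
    hψc hu0 hv0 (fun p hp => by
      obtain ⟨h1, h2, h3⟩ := hgy p hp
      exact (Real.sin_pos_of_pos_of_lt_pi (mul_pos (by linarith [hg2 p.1]) h1) h3).ne') k1 k2 k3 (by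
      intro p hp c hc
      obtain ⟨y0, hytwo, hgypi⟩ := hgy p hp
      obtain ⟨cb1, cb2⟩ := cot_bounds b0 b1 (g p.1) p.2 hb0p.1 hb0p.2 hb1p.1 hb1p.2 (hg2 _) (hg1 _) y0 hgypi
      rw [← hc, ← hC0] at cb1 cb2
      have he0 : 0 ≤ e p.1 := e.nonneg
      have he1 : e p.1 ≤ 1 := e.le_one
      refine hmain _ _ _ _ _ _ _ _ _ _ _ _ _ _ _ _ _ _ _ _ _ _ (1 / (1 + p.1 ^ 2)) α (by positivity) he0 he1
        ?_ ?_ ?_ ?_ ?_ hα2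
      · rw [hBdef p, (lineX (ha₂.differentiable (by norm_num) p)).deriv,
          (lineY (ha₁.differentiable (by norm_num) p)).deriv]
        rfl
      · by_cases hx : |p.1 - p0.1| ≤ r
        · have : e p.1 = 1 := e.one_of_mem_closedBall (by
            rw [Metric.mem_closedBall, Real.dist_eq]; exact hx)
          rw [this, mul_one]; exact (hwx p.1).1
        · have h1 := (hwx p.1).2 (not_le.1 hx)
          nlinarith [mul_nonneg hC2 he0]
      · obtain ⟨z1, z2⟩ := hzy p.2 c y0 hytwo (fun h => cb1 (by linarith)) (fun h => cb2 (by linarith))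
        have hBn : 0 ≤ C4 / β * B p ^ 2 := by positivity
        by_cases hy : p0.2 - r ≤ p.2 ∧ p.2 ≤ p0.2 + r
        · by_cases hx : |p.1 - p0.1| < 2 * r
          · have hb := hbox p hx (abs_le.2 ⟨by linarith [hy.1], by linarith [hy.2]⟩)
            have h1 : C4 ≤ C4 / β * B p ^ 2 := by
              calc C4 = C4 / β * β := by field_simp
                _ ≤ _ := by gcongr
            have h2 := mul_le_mul_of_nonneg_left z1 he0
            have h3 : e p.1 * C4 ≤ C4 := mul_le_of_le_one_left hC4 he1
            linarith
          · have : e p.1 = 0 := e.zero_of_le_dist (by rw [Real.dist_eq]; exact not_lt.1 hx)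
            simp only [this, zero_mul]; linarith
        · have h2 := mul_le_mul_of_nonneg_left (z2 hy) he0
          linarith
      · by_cases hpB : p ∈ tsupport B
        · left
          have e1 := hm1 p hpB
          have e2 := hm2 p hpB
          have e3 := hm3 p hpB
          rw [Real.norm_eq_abs] at e1 e2 e3
          have := le_abs_self m1
          have := le_abs_self m2
          have := le_abs_self m3
          have := abs_nonneg m1
          have := abs_nonneg m2
          have := abs_nonneg m3
          refine ⟨by linarith, by linarith, by linarith, ?_, ?_⟩
          · have h1 := hR p hpB
            rw [Real.norm_eq_abs] at h1
            have h2 := pow_le_pow_left₀ (abs_nonneg _) h1 2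
            rw [sq_abs] at h2
            exact one_div_le_one_div_of_le (by positivity) (by linarith)
          · exact abs_le.2 ⟨cb1 (hbd p hpB).2, cb2 (hbd p hpB).1⟩
        · right
          have h := pd_zero (isClosed_tsupport B) (fun q hq => image_eq_zero_of_notMem_tsupport hq) hpB
          exact ⟨image_eq_zero_of_notMem_tsupport hpB, h.1, h.2⟩
      · have := hg3 p.1
        have := hf1 p.1
        linarith)
  have hout : ∀ p : ℝ × ℝ, ¬ (0 < p.2 ∧ p.2 < π * (1 + f p.1)) → p ∉ tsupport ψ := fun p hp h => hp (hψS h)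
  have G1 := iter_integral (fun x => π * (1 + f x)) _ I1 (fun p hp => by
    simp [hu0 p (hout p hp), hv0 p (hout p hp)])
  have G2 := iter_integral (fun x => π * (1 + f x)) _ I2 (fun p hp => by
    have h1 := pd_zero (isClosed_tsupport ψ) hu0 (hout p hp)
    have h2 := pd_zero (isClosed_tsupport ψ) hv0 (hout p hp)
    simp [hu0 p (hout p hp), hv0 p (hout p hp), h1, h2])
  have E1 : ∀ x y : ℝ, ‖ψ (x, y)‖ ^ 2 = u (x, y) ^ 2 + v (x, y) ^ 2 := by
    intro x y
    rw [Complex.sq_norm, Complex.normSq_apply, hu, hv]; ring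
  have E2 : ∀ x y : ℝ, (‖Complex.I * deriv (fun t => ψ (t, y)) x + (a₁ (x, y) : ℂ) * ψ (x, y)‖ ^ 2
      + ‖Complex.I * deriv (fun t => ψ (x, t)) y + (a₂ (x, y) : ℂ) * ψ (x, y)‖ ^ 2)
      = (a₁ (x, y) * u (x, y) - pdx v (x, y)) ^ 2 + (pdx u (x, y) + a₁ (x, y) * v (x, y)) ^ 2
      + ((a₂ (x, y) * u (x, y) - pdy v (x, y)) ^ 2 + (pdy u (x, y) + a₂ (x, y) * v (x, y)) ^ 2) := by
    intro x y
    rw [norm_sq_aux, norm_sq_aux, (lineX (p := (x, y)) (hψd _)).deriv, (lineY (p := (x, y)) (hψd _)).deriv]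
    simp only [pdx, pdy, hu, hv, re_im_deriv hψd]
  simp only [E1, E2]
  rw [ge_iff_le, G1, G2]
  exact hle
end

section
/- Let f : ℝ → [0, ∞) be three times continuously differentiable, not identically zero, such that for some α > 0 one has |f(x)| ≤ α/(1+x²), |f'(x)| ≤ α/(1+x²), |f''(x)| ≤ α/(1+x²), |f'''(x)| ≤ α/(1+x²) for all x ∈ ℝ, and suppose that f'(x)² ≤ (12/(4π²+3)) · f(x)(2 + f(x)) for every x ∈ ℝ (equivalently |f'(x)| ≤ (2√3/√(4π²+3)) √(f(x)(2+f(x)))), with strict inequality at at least one point. Set g = 1 + f and Ω_f = {(x,y) ∈ ℝ² : 0 < y < π g(x)}. Then there exists a real-valued r ∈ C_c^∞(ℝ) such that the function φ(x, y) = r(x) sin(y / g(x)) satisfies ∫_{Ω_f} (|φ_x(x,y)|² + |φ_y(x,y)|²) dx dy < ∫_{Ω_f} |φ(x,y)|² dx dy. (This is the quadratic-form formulation of the non-emptiness of the discrete spectrum of the non-magnetic Dirichlet Laplacian on Ω_f below the threshold 1 of its essential spectrum.) -/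
open MeasureTheory Real

lemma ndsn_inner (A B C g : ℝ) (hg : 0 < g) :
    ∫ y in Set.Ioo 0 (π * g), ((A * Real.sin (y / g) + B * ((y / g) * Real.cos (y / g))) ^ 2
      + C * Real.cos (y / g) ^ 2)
    = π / 2 * g * (A ^ 2 - A * B + B ^ 2 * (π ^ 2 / 3 + 1 / 2) + C) := by
  rw [← integral_Ioc_eq_integral_Ioo, ← intervalIntegral.integral_of_le (by positivity)]
  have h1 := intervalIntegral.integral_comp_div (a := 0) (b := π * g)
    (fun s => (A * Real.sin s + B * (s * Real.cos s)) ^ 2 + C * Real.cos s ^ 2) hg.ne'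
  rw [h1, zero_div, mul_div_assoc, div_self hg.ne', mul_one, smul_eq_mul]
  have h2 : ∀ s ∈ Set.uIcc 0 π, HasDerivAt (fun s : ℝ =>
      A ^ 2 * ((s - Real.sin s * Real.cos s) / 2)
      + 2 * A * B * (s * Real.sin s ^ 2 / 2 - s / 4 + Real.sin s * Real.cos s / 4)
      + B ^ 2 * (s ^ 3 / 6 + s ^ 2 * (Real.sin s * Real.cos s) / 2
          - (s * Real.sin s ^ 2 / 2 - s / 4 + Real.sin s * Real.cos s / 4))
      + C * ((s + Real.sin s * Real.cos s) / 2))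
      ((A * Real.sin s + B * (s * Real.cos s)) ^ 2 + C * Real.cos s ^ 2) s := by
    intro s _
    have hid := hasDerivAt_id' s
    have hs := Real.hasDerivAt_sin s
    have hc := Real.hasDerivAt_cos s
    have hsc := hs.mul hc
    have k1 := ((hid.sub hsc).div_const 2).const_mul (A ^ 2)
    have k0 := (((hid.mul (hs.pow 2)).div_const 2).sub (hid.div_const 4)).add (hsc.div_const 4)
    have k2 := k0.const_mul (2 * A * B)
    have k3 := ((((hid.pow 3).div_const 6).add (((hid.pow 2).mul hsc).div_const 2)).sub
      k0).const_mul (B ^ 2)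
    have k4 := ((hid.add hsc).div_const 2).const_mul C
    refine (((k1.add k2).add k3).add k4).congr_deriv ?_
    simp
    have e : Real.sin s ^ 2 = 1 - Real.cos s ^ 2 := by
      have := Real.sin_sq_add_cos_sq s; linarith
    ring_nf
    simp only [e]
    ring
  rw [intervalIntegral.integral_eq_sub_of_hasDerivAt h2
    (Continuous.intervalIntegrable (by fun_prop) _ _)]
  simp
  ring

/-- smooth approximation -/
lemma ndsn_approx (K : ℝ × ℝ × ℝ → ℝ) (hK : Continuous K) (w w' : ℝ → ℝ)
    (hw : ∀ x, HasDerivAt w (w' x) x) (hw' : Continuous w') (R : ℝ) (hR : 0 < R)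
    (hneg : ∫ x in Set.Icc (-R) R, K (x, w x, w' x) < 0) :
    ∃ p p' : ℝ → ℝ, ContDiff ℝ (⊤ : ℕ∞) p ∧ (∀ x, HasDerivAt p (p' x) x) ∧
      ∫ x in Set.Icc (-R) R, K (x, p x, p' x) < 0 := by
  have hwc : Continuous w := continuous_iff_continuousAt.2 fun x => (hw x).continuousAt
  have hex : ∀ n : ℕ, ∃ p p' : ℝ → ℝ, ContDiff ℝ (⊤ : ℕ∞) p ∧ (∀ x, HasDerivAt p (p' x) x) ∧
      Continuous p' ∧ 
      ∀ x ∈ Set.Icc (-R) R, |p' x - w' x| ≤ 1 / ((n : ℝ) + 1) ∧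
        |p x - w x| ≤ R * (1 / ((n : ℝ) + 1)) := by
    intro n
    have hε : (0 : ℝ) < 1 / ((n : ℝ) + 1) := by positivity
    obtain ⟨P, hP⟩ := exists_polynomial_near_of_continuousOn (-R) R w' hw'.continuousOn _ hε
    have hPc : Continuous (fun x => P.eval x) := P.continuous
    have hder : ∀ x, HasDerivAt (fun x => w 0 + ∫ t in (0:ℝ)..x, P.eval t) (P.eval x) x := by
      intro x
      exact (intervalIntegral.integral_hasDerivAt_right (hPc.intervalIntegrable _ _)
        (hPc.stronglyMeasurableAtFilter _ _) hPc.continuousAt).const_add _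
    refine ⟨_, _, ?_, hder, hPc, ?_⟩
    · rw [contDiff_infty_iff_deriv]
      refine ⟨fun x => (hder x).differentiableAt, ?_⟩
      have : deriv (fun x => w 0 + ∫ t in (0:ℝ)..x, P.eval t) = fun x => P.eval x :=
        funext fun x => (hder x).deriv
      rw [this]
      simpa using P.contDiff_aeval (𝕜 := ℝ) (⊤ : ℕ∞)
    · intro x hx
      refine ⟨(hP x hx).le, ?_⟩
      have e : w x = w 0 + ∫ t in (0:ℝ)..x, w' t := by
        rw [intervalIntegral.integral_eq_sub_of_hasDerivAt (fun t _ => hw t)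
          (hw'.intervalIntegrable _ _)]
        ring
      rw [e, add_sub_add_left_eq_sub, ← intervalIntegral.integral_sub
        (hPc.intervalIntegrable _ _) (hw'.intervalIntegrable _ _), ← Real.norm_eq_abs]
      refine (intervalIntegral.norm_integral_le_of_norm_le_const (C := 1 / ((n : ℝ) + 1))
        ?_).trans ?_
      · intro t ht
        refine (hP t ?_).le
        have h0 : (0:ℝ) ∈ Set.Icc (-R) R := ⟨by linarith, hR.le⟩
        exact Set.uIcc_subset_Icc h0 hx (Set.uIoc_subset_uIcc ht)
      · rw [mul_comm, sub_zero]
        have : |x| ≤ R := abs_le.2 hx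
        gcongr
  choose p p' hp1 hp2 hp2c hp3 using hex
  obtain ⟨M1, hM1⟩ := (isCompact_Icc (a := -R) (b := R)).exists_bound_of_continuousOn
    hwc.continuousOn
  obtain ⟨M2, hM2⟩ := (isCompact_Icc (a := -R) (b := R)).exists_bound_of_continuousOn
    hw'.continuousOn
  obtain ⟨C, hC⟩ := ((isCompact_Icc (a := -R) (b := R)).prod
    ((isCompact_Icc (a := -(M1 + R)) (b := M1 + R)).prod
      (isCompact_Icc (a := -(M2 + 1)) (b := M2 + 1)))).exists_bound_of_continuousOn
      hK.continuousOn
  have ht0 : Filter.Tendsto (fun n : ℕ => 1 / ((n : ℝ) + 1)) Filter.atTop (nhds 0) :=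
    tendsto_one_div_add_atTop_nhds_zero_nat
  have hle1 : ∀ n : ℕ, 1 / ((n : ℝ) + 1) ≤ 1 := by
    intro n
    rw [div_le_one (by positivity)]
    have : (0 : ℝ) ≤ n := n.cast_nonneg
    linarith
  have hlim : Filter.Tendsto (fun n => ∫ x in Set.Icc (-R) R, K (x, p n x, p' n x)) Filter.atTop
      (nhds (∫ x in Set.Icc (-R) R, K (x, w x, w' x))) := by
    refine tendsto_integral_of_dominated_convergence (fun _ => C) ?_ ?_ ?_ ?_
    · intro n
      have := (hp1 n).continuous
      have := hp2c n
      exact Continuous.aestronglyMeasurable (by fun_prop)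
    · exact integrable_const _
    · intro n
      refine (ae_restrict_iff' measurableSet_Icc).2 (Filter.Eventually.of_forall fun x hx => ?_)
      apply hC
      have h1 := hM1 x hx
      have h2 := hM2 x hx
      rw [Real.norm_eq_abs] at h1 h2
      obtain ⟨h3, h4⟩ := hp3 n x hx
      have h5 : |p' n x - w' x| ≤ 1 := h3.trans (hle1 n)
      have h6 : |p n x - w x| ≤ R := h4.trans (by nlinarith [hle1 n])
      rw [abs_le] at h1 h2 h5 h6
      refine ⟨hx, ⟨?_, ?_⟩, ⟨?_, ?_⟩⟩ <;> simp only <;> linarith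
    · refine (ae_restrict_iff' measurableSet_Icc).2 (Filter.Eventually.of_forall fun x hx => ?_)
      have a1 : Filter.Tendsto (fun n => p n x) Filter.atTop (nhds (w x)) := by
        rw [tendsto_iff_norm_sub_tendsto_zero]
        refine squeeze_zero (fun _ => norm_nonneg _) (fun n => (hp3 n x hx).2) ?_
        simpa using ht0.const_mul R
      have a2 : Filter.Tendsto (fun n => p' n x) Filter.atTop (nhds (w' x)) := by
        rw [tendsto_iff_norm_sub_tendsto_zero]
        exact squeeze_zero (fun _ => norm_nonneg _) (fun n => (hp3 n x hx).1) ht0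
      exact (hK.tendsto _).comp (tendsto_const_nhds.prodMk_nhds (a1.prodMk_nhds a2))
  obtain ⟨n, hn⟩ := (hlim.eventually (gt_mem_nhds hneg)).exists
  exact ⟨p n, p' n, hp1 n, hp2 n, hn⟩

/-- a smooth cutoff with small Dirichlet energy -/
lemma ndsn_cutoff (V : ℝ → ℝ) (hV : Continuous V) (hV0 : ∀ x, V x ≤ 0) (hV1 : ∃ x, V x < 0) :
    ∃ χ : ℝ → ℝ, ∃ R : ℝ, 0 < R ∧ ContDiff ℝ (⊤ : ℕ∞) χ ∧ tsupport χ ⊆ Set.Icc (-R) R ∧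
      ∫ x in Set.Icc (-R) R, ((deriv χ x) ^ 2 + χ x ^ 2 * V x) < 0 := by
  obtain ⟨x0, hx0⟩ := hV1
  let b : ContDiffBump (0 : ℝ) := ⟨1, 2, one_pos, one_lt_two⟩
  have hbs : ContDiff ℝ (⊤ : ℕ∞) (b : ℝ → ℝ) := b.contDiff
  have hbd : Continuous (deriv (b : ℝ → ℝ)) := hbs.continuous_deriv (by simp)
  obtain ⟨C, hC⟩ := (isCompact_Icc (a := (-2:ℝ)) (b := 2)).exists_bound_of_continuousOn
    hbd.continuousOn
  have hC0 : 0 ≤ C := (norm_nonneg _).trans (hC 0 ⟨by norm_num, by norm_num⟩)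
  set c : ℝ := -∫ x in (x0 - 1)..(x0 + 1), V x with hc
  have hcpos : 0 < c := by
    rw [hc, ← intervalIntegral.integral_neg]
    refine intervalIntegral.integral_pos (by linarith) hV.neg.continuousOn
      (fun x _ => neg_nonneg.2 (hV0 x)) ⟨x0, ⟨by linarith, by linarith⟩, by simpa using hx0⟩
  -- scale
  obtain ⟨N, hN1, hN2⟩ : ∃ N : ℝ, |x0| + 1 ≤ N ∧ 4 * C ^ 2 < c * N := by
    refine ⟨max (|x0| + 1) (4 * C ^ 2 / c + 1), le_max_left _ _, ?_⟩
    have := le_max_right (|x0| + 1) (4 * C ^ 2 / c + 1)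
    calc 4 * C ^ 2 < c * (4 * C ^ 2 / c + 1) := by
          rw [mul_add, mul_div_cancel₀ _ hcpos.ne']; linarith
      _ ≤ _ := by gcongr
  have hN : 0 < N := by have := abs_nonneg x0; linarith
  have hder : ∀ x, deriv (fun x => b (x / N)) x = deriv (b : ℝ → ℝ) (x / N) / N := by
    intro x
    have h1 : HasDerivAt (b : ℝ → ℝ) (deriv (b : ℝ → ℝ) (x / N)) (x / N) :=
      ((hbs.differentiable (by simp)) _).hasDerivAt
    have h2 := h1.comp x ((hasDerivAt_id' x).div_const N)
    have h3 := h2.deriv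
    rw [mul_one_div] at h3
    exact h3
  refine ⟨fun x => b (x / N), 2 * N, by positivity, ?_, ?_, ?_⟩
  · exact hbs.comp (contDiff_id.div_const N)
  · refine closure_minimal ?_ isClosed_Icc
    intro x hx
    rw [Function.mem_support] at hx
    have h1 : x / N ∈ Function.support (b : ℝ → ℝ) := hx
    rw [b.support_eq, Metric.mem_ball, Real.dist_eq, sub_zero] at h1
    have h1' : |x / N| < 2 := h1
    rw [abs_div, abs_of_pos hN, div_lt_iff₀ hN] at h1'
    exact abs_le.1 h1'.le
  · simp only [hder]
    have hbc : Continuous (b : ℝ → ℝ) := hbs.continuous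
    have c1 : Continuous fun x => (deriv (b : ℝ → ℝ) (x / N) / N) ^ 2 := by fun_prop
    have c2 : Continuous fun x => (b (x / N)) ^ 2 * V x := by fun_prop
    rw [integral_add (c1.integrableOn_Icc) (c2.integrableOn_Icc)]
    have e1 : ∫ x in Set.Icc (-(2 * N)) (2 * N), (deriv (b : ℝ → ℝ) (x / N) / N) ^ 2
        ≤ 4 * C ^ 2 / N := by
      have : ∫ x in Set.Icc (-(2 * N)) (2 * N), (deriv (b : ℝ → ℝ) (x / N) / N) ^ 2
        ≤ ∫ x in Set.Icc (-(2 * N)) (2 * N), (C / N) ^ 2 := by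
        refine setIntegral_mono_on c1.integrableOn_Icc continuous_const.integrableOn_Icc
          measurableSet_Icc ?_
        intro x hx
        have h3 := hC (x / N) ⟨by rw [le_div_iff₀ hN]; linarith [hx.1],
          by rw [div_le_iff₀ hN]; linarith [hx.2]⟩
        rw [Real.norm_eq_abs] at h3
        rw [div_pow, div_pow]
        gcongr ?_ / _
        exact sq_le_sq' (by linarith [abs_le.1 h3]) (abs_le.1 h3).2
      refine this.trans (le_of_eq ?_)
      rw [setIntegral_const, smul_eq_mul, Measure.real, Real.volume_Icc,
        ENNReal.toReal_ofReal (by linarith)]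
      field_simp
      ring
    have e2 : ∫ x in Set.Icc (-(2 * N)) (2 * N), (b (x / N)) ^ 2 * V x ≤ -c := by
      have hsub : Set.Icc (x0 - 1) (x0 + 1) ⊆ Set.Icc (-(2 * N)) (2 * N) := by
        have := neg_abs_le x0
        have := le_abs_self x0
        exact Set.Icc_subset_Icc (by linarith) (by linarith)
      have h4 : ∫ x in Set.Icc (x0 - 1) (x0 + 1), -((b (x / N)) ^ 2 * V x) ≤
          ∫ x in Set.Icc (-(2 * N)) (2 * N), -((b (x / N)) ^ 2 * V x) := by
        refine setIntegral_mono_set c2.neg.integrableOn_Icc ?_ hsub.eventuallyLE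
        refine Filter.Eventually.of_forall fun x => ?_
        have := mul_nonneg (sq_nonneg (b (x / N))) (neg_nonneg.2 (hV0 x))
        simp only [Pi.zero_apply]
        linarith
      rw [integral_neg, integral_neg] at h4
      have h5 : ∫ x in Set.Icc (x0 - 1) (x0 + 1), (b (x / N)) ^ 2 * V x = -c := by
        rw [hc, neg_neg, intervalIntegral.integral_of_le (by linarith),
          ← integral_Icc_eq_integral_Ioc]
        refine setIntegral_congr_fun measurableSet_Icc ?_
        intro x hx
        have hb1 : b (x / N) = 1 := by
          apply b.one_of_mem_closedBall
          rw [Metric.mem_closedBall, Real.dist_eq, sub_zero]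
          change |x / N| ≤ 1
          rw [abs_div, abs_of_pos hN, div_le_one hN, abs_le]
          have := neg_abs_le x0
          have := le_abs_self x0
          constructor <;> linarith [hx.1, hx.2]
        simp [hb1]
      linarith
    have e3 : 4 * C ^ 2 / N < c := by rwa [div_lt_iff₀ hN]
    linarith

theorem nonmagnetic_discrete_spectrum_nonempty
    (f : ℝ → ℝ) (hf0 : ∀ x, 0 ≤ f x) (hf : ContDiff ℝ 3 f)
    (hfne : ∃ x, f x ≠ 0)
    (α : ℝ) (hα : 0 < α)
    (hb0 : ∀ x, |f x| ≤ α / (1 + x ^ 2))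
    (hb1 : ∀ x, |deriv f x| ≤ α / (1 + x ^ 2))
    (hb2 : ∀ x, |deriv (deriv f) x| ≤ α / (1 + x ^ 2))
    (hb3 : ∀ x, |deriv (deriv (deriv f)) x| ≤ α / (1 + x ^ 2))
    (hcrit : ∀ x, (deriv f x) ^ 2 ≤ (12 / (4 * π ^ 2 + 3)) * (f x * (2 + f x)))
    (hstrict : ∃ x, (deriv f x) ^ 2 < (12 / (4 * π ^ 2 + 3)) * (f x * (2 + f x))) :
    ∃ r : ℝ → ℝ, ContDiff ℝ (⊤ : ℕ∞) r ∧ HasCompactSupport r ∧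
      (∫ x : ℝ, ∫ y in Set.Ioo 0 (π * (1 + f x)),
          ((deriv (fun t => r t * Real.sin (y / (1 + f t))) x) ^ 2
            + (deriv (fun t => r x * Real.sin (t / (1 + f x))) y) ^ 2))
        < ∫ x : ℝ, ∫ y in Set.Ioo 0 (π * (1 + f x)),
            (r x * Real.sin (y / (1 + f x))) ^ 2 := by
  have hg : ∀ x, 0 < 1 + f x := fun x => by linarith [hf0 x]
  have hgne : ∀ x, 1 + f x ≠ 0 := fun x => (hg x).ne'
  have hfc : Continuous f := hf.continuous
  have hDc : Continuous (deriv f) := hf.continuous_deriv (by norm_num)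
  have hfd : ∀ x, HasDerivAt f (deriv f x) x := fun x =>
    ((hf.differentiable (by norm_num)) x).hasDerivAt
  have hgd : ∀ x, HasDerivAt (fun t => 1 + f t) (deriv f x) x := fun x => (hfd x).const_add 1
  -- the effective potential
  let V : ℝ → ℝ := fun x => ((deriv f x) ^ 2 * (π ^ 2 / 3 + 1 / 4) - f x * (2 + f x))
    / (1 + f x) ^ 2
  have hVc : Continuous V := by
    refine Continuous.div (by fun_prop) (by fun_prop) fun x => pow_ne_zero _ (hgne x)
  have hk : (12 / (4 * π ^ 2 + 3)) * (π ^ 2 / 3 + 1 / 4) = 1 := by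
    field_simp
    ring
  have hkp : 0 < π ^ 2 / 3 + 1 / 4 := by positivity
  obtain ⟨χ, R, hR, hχs, hχt, hχneg⟩ := ndsn_cutoff V hVc
    (by
      intro x
      refine div_nonpos_of_nonpos_of_nonneg ?_ (by positivity)
      have := mul_le_mul_of_nonneg_right (hcrit x) hkp.le
      have e : (12 / (4 * π ^ 2 + 3)) * (f x * (2 + f x)) * (π ^ 2 / 3 + 1 / 4)
        = f x * (2 + f x) := by
        linear_combination (f x * (2 + f x)) * hk
      linarith)
    (by
      obtain ⟨x, hx⟩ := hstrict
      refine ⟨x, div_neg_of_neg_of_pos ?_ (pow_pos (hg x) 2)⟩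
      have := mul_lt_mul_of_pos_right hx hkp
      have e : (12 / (4 * π ^ 2 + 3)) * (f x * (2 + f x)) * (π ^ 2 / 3 + 1 / 4)
        = f x * (2 + f x) := by
        linear_combination (f x * (2 + f x)) * hk
      linarith)
  have hχc : Continuous χ := hχs.continuous
  have hχdc : Continuous (deriv χ) := hχs.continuous_deriv (by simp)
  have hχd : ∀ x, HasDerivAt χ (deriv χ x) x := fun x =>
    ((hχs.differentiable (by simp)) x).hasDerivAt
  -- energy density
  let E : ℝ → ℝ → ℝ → ℝ := fun x a a' => (1 + f x) * a' ^ 2 + a * a' * deriv f x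
    + a ^ 2 * (deriv f x ^ 2 / (1 + f x)) * (π ^ 2 / 3 + 1 / 2) + a ^ 2 / (1 + f x)
    - a ^ 2 * (1 + f x)
  let K : ℝ × ℝ × ℝ → ℝ := fun z =>
    E z.1 (χ z.1 * z.2.1) (deriv χ z.1 * z.2.1 + χ z.1 * z.2.2)
  have hKc : Continuous K := by
    have hne : ∀ z : ℝ × ℝ × ℝ, 1 + f z.1 ≠ 0 := fun z => hgne _
    simp only [K, E]
    fun_prop (disch := assumption)
  let w : ℝ → ℝ := fun x => (√(1 + f x))⁻¹
  let w' : ℝ → ℝ := fun x => -(deriv f x / (2 * √(1 + f x))) / (√(1 + f x)) ^ 2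
  have hsq : ∀ x, √(1 + f x) ≠ 0 := fun x => (Real.sqrt_pos.2 (hg x)).ne'
  have hw : ∀ x, HasDerivAt w (w' x) x := by
    intro x
    exact ((hgd x).sqrt (hgne x)).inv (hsq x)
  have hw'c : Continuous w' := by
    have h2 : ∀ x, 2 * √(1 + f x) ≠ 0 := fun x => mul_ne_zero two_ne_zero (hsq x)
    have h3 : ∀ x, √(1 + f x) ^ 2 ≠ 0 := fun x => pow_ne_zero _ (hsq x)
    simp only [w']
    fun_prop (disch := assumption)
  obtain ⟨p, p', hps, hpd, hpneg⟩ := ndsn_approx K hKc w w' hw hw'c R hR (by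
    refine lt_of_eq_of_lt ?_ hχneg
    refine integral_congr_ae (Filter.Eventually.of_forall fun x => ?_)
    simp only [K, E, w, w', V]
    obtain ⟨s, hs⟩ : ∃ s, s = √(1 + f x) := ⟨_, rfl⟩
    have hs2 : s ^ 2 = 1 + f x := by rw [hs, Real.sq_sqrt (hg x).le]
    have hs0 : s ≠ 0 := hs ▸ hsq x
    rw [← hs, ← hs2]
    have hfx : f x = s ^ 2 - 1 := by linarith
    rw [hfx]
    field_simp
    ring)
  have hrd : ∀ x, HasDerivAt (fun t => χ t * p t) (deriv χ x * p x + χ x * p' x) x := fun x =>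
    (hχd x).mul (hpd x)
  have hχcs : HasCompactSupport χ := HasCompactSupport.of_support_subset_isCompact
    (isCompact_Icc (a := -R) (b := R)) ((subset_tsupport χ).trans hχt)
  refine ⟨fun t => χ t * p t, hχs.mul hps, hχcs.mul_right, ?_⟩
  have hpc : Continuous p := hps.continuous
  have hp'c : Continuous p' := by
    have : deriv p = p' := funext fun x => (hpd x).deriv
    rw [← this]
    exact hps.continuous_deriv (by simp)
  have hz : ∀ x, x ∉ Set.Icc (-R) R → χ x = 0 ∧ deriv χ x = 0 := by
    intro x hx
    have h1 : x ∉ tsupport χ := fun h => hx (hχt h)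
    refine ⟨image_eq_zero_of_notMem_tsupport h1, ?_⟩
    by_contra h2
    exact h1 (support_deriv_subset h2)
  -- the two inner integrals
  have hL : ∀ x, ∫ y in Set.Ioo 0 (π * (1 + f x)),
          ((deriv (fun t => χ t * p t * Real.sin (y / (1 + f t))) x) ^ 2
            + (deriv (fun t => χ x * p x * Real.sin (t / (1 + f x))) y) ^ 2)
      = π / 2 * (K (x, p x, p' x) + (χ x * p x) ^ 2 * (1 + f x)) := by
    intro x
    have hd : ∀ y, (deriv (fun t => χ t * p t * Real.sin (y / (1 + f t))) x) ^ 2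
            + (deriv (fun t => χ x * p x * Real.sin (t / (1 + f x))) y) ^ 2
        = ((deriv χ x * p x + χ x * p' x) * Real.sin (y / (1 + f x))
            + (-(χ x * p x * (deriv f x / (1 + f x)))) *
              ((y / (1 + f x)) * Real.cos (y / (1 + f x)))) ^ 2
          + (χ x * p x / (1 + f x)) ^ 2 * Real.cos (y / (1 + f x)) ^ 2 := by
      intro y
      have d1 := (hrd x).mul (((hasDerivAt_const x y).div (hgd x) (hgne x)).sin)
      have d2 := (((hasDerivAt_id' y).div_const (1 + f x)).sin).const_mul (χ x * p x)
      have d1' : deriv (fun t => χ t * p t * Real.sin (y / (1 + f t))) x = _ := d1.deriv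
      rw [d1', d2.deriv]
      have := hgne x
      simp only [Pi.div_apply]
      field_simp
      ring
    simp only [hd]
    rw [ndsn_inner _ _ _ _ (hg x)]
    simp only [K, E]
    have := hgne x
    field_simp
    ring
  have hRt : ∀ x, ∫ y in Set.Ioo 0 (π * (1 + f x)),
            (χ x * p x * Real.sin (y / (1 + f x))) ^ 2
      = π / 2 * ((χ x * p x) ^ 2 * (1 + f x)) := by
    intro x
    have := ndsn_inner (χ x * p x) 0 0 _ (hg x)
    simp only [zero_mul, add_zero] at this
    rw [this]
    ring
  simp only [hL, hRt]
  have cK : Continuous fun x => K (x, p x, p' x) := by fun_prop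
  have cS : Continuous fun x => (χ x * p x) ^ 2 * (1 + f x) := by fun_prop
  have hK0 : ∀ x, x ∉ Set.Icc (-R) R → K (x, p x, p' x) = 0 := by
    intro x hx
    simp [K, E, hz x hx]
  have iK : Integrable fun x => K (x, p x, p' x) :=
    cK.integrable_of_hasCompactSupport (HasCompactSupport.intro isCompact_Icc hK0)
  have iS : Integrable fun x => (χ x * p x) ^ 2 * (1 + f x) :=
    cS.integrable_of_hasCompactSupport (HasCompactSupport.intro (isCompact_Icc (a := -R) (b := R))
      (fun x hx => by simp [hz x hx]))
  rw [integral_const_mul, integral_const_mul, integral_add iK iS,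
    ← setIntegral_eq_integral_of_forall_compl_eq_zero hK0]
  have : 0 < π / 2 := by positivity
  nlinarith
end

section
/- Let V : ℝ → ℝ be a continuous function with V(x) ≤ 0 for all x ∈ ℝ, and suppose there exists x₀ ∈ ℝ with V(x₀) < 0. Then there exists a real-valued function v ∈ C_c^∞(ℝ) such that ∫_ℝ ( v'(x)² + V(x) v(x)² ) dx < 0. -/
open MeasureTheory Real

/-- A one-dimensional Schrödinger operator with a non-positive,
non-trivial continuous potential has a negative bound state: in quadratic-form terms,
there is a smooth compactly supported `v` with `∫ (v'² + V v²) < 0`. -/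
theorem schrodinger_negative_bound_state
    (V : ℝ → ℝ) (hV : Continuous V) (hVnonpos : ∀ x, V x ≤ 0)
    (hVne : ∃ x₀, V x₀ < 0) :
    ∃ v : ℝ → ℝ, ContDiff ℝ (⊤ : ℕ∞) v ∧ HasCompactSupport v ∧
      (∫ x : ℝ, (deriv v x ^ 2 + V x * v x ^ 2)) < 0 := by
  obtain ⟨x₀, hx₀⟩ := hVne
  let f : ContDiffBump (0 : ℝ) := ⟨1, 2, by norm_num, by norm_num⟩
  let g : ContDiffBump x₀ := ⟨1 / 2, 1, by norm_num, by norm_num⟩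
  have hgc : HasCompactSupport (fun x => -V x * g x ^ 2) := by
    refine g.hasCompactSupport.mono ?_
    intro x hx h0
    exact hx (by simp [h0])
  have hgcont : Continuous (fun x => -V x * g x ^ 2) := by
    have := g.continuous
    fun_prop
  have hCpos : 0 < ∫ x, -V x * g x ^ 2 := by
    refine hgcont.integral_pos_of_hasCompactSupport_nonneg_nonzero (x := x₀) hgc ?_ ?_
    · intro x
      have := hVnonpos x
      exact mul_nonneg (by linarith) (sq_nonneg _)
    · have : g x₀ = 1 := g.one_of_mem_closedBall (by simp [g])
      rw [this]
      simp [hx₀.ne]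
  set C := ∫ x, -V x * g x ^ 2 with hC
  have hK0 : 0 ≤ ∫ y, deriv f y ^ 2 := integral_nonneg fun y => sq_nonneg _
  set K := ∫ y, deriv f y ^ 2 with hK
  obtain ⟨e, he0, he1, heK⟩ : ∃ e : ℝ, 0 < e ∧ e ≤ 1 ∧ e * K < C := by
    refine ⟨min 1 (C / (K + 1)), by positivity, min_le_left _ _, ?_⟩
    have h1 : min 1 (C / (K + 1)) ≤ C / (K + 1) := min_le_right _ _
    calc _ ≤ C / (K + 1) * K := by gcongr
      _ < C := by
        rw [div_mul_eq_mul_div, div_lt_iff₀ (by positivity)]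
        nlinarith
  let v : ℝ → ℝ := fun x => f (e * (x - x₀))
  have hvs : ContDiff ℝ (⊤ : ℕ∞) v := by
    have : ContDiff ℝ (⊤ : ℕ∞) f := f.contDiff
    exact this.comp (by fun_prop)
  have hvc : HasCompactSupport v := by
    refine HasCompactSupport.of_support_subset_isCompact
      (isCompact_closedBall x₀ (2 / e)) ?_
    intro x hx
    by_contra hn
    apply hx
    apply f.zero_of_le_dist
    rw [Metric.mem_closedBall, not_le, div_lt_iff₀ he0, Real.dist_eq] at hn
    rw [Real.dist_eq, sub_zero, abs_mul, abs_of_pos he0]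
    show (2 : ℝ) ≤ _
    linarith
  have hder : ∀ x, deriv v x = e * deriv f (e * (x - x₀)) := by
    intro x
    have h1 : HasDerivAt f (deriv f (e * (x - x₀))) (e * (x - x₀)) :=
      ((f.contDiff (n := 1)).differentiable (by norm_num) _).hasDerivAt
    have h2 : HasDerivAt (fun x => e * (x - x₀)) (e * 1) x :=
      ((hasDerivAt_id x).sub_const x₀).const_mul e
    have := (h1.comp x h2).deriv
    rw [mul_one, mul_comm] at this
    exact this
  have hI : ∫ x, deriv v x ^ 2 = e * K := by
    simp_rw [hder, mul_pow]
    rw [integral_const_mul,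
      integral_sub_right_eq_self (fun x => deriv f (e * x) ^ 2) x₀,
      Measure.integral_comp_mul_left (fun x => deriv f x ^ 2) e, ← hK,
      abs_of_pos (inv_pos.2 he0), smul_eq_mul]
    field_simp
  have hvcont : Continuous v := hvs.continuous
  have hdcont : Continuous (deriv v) := hvs.continuous_deriv (by simp)
  have i1 : Integrable (fun x => deriv v x ^ 2) := by
    refine Continuous.integrable_of_hasCompactSupport (by fun_prop) ?_
    refine hvc.deriv.mono ?_
    intro x hx h0
    exact hx (by simp [h0])
  have i2 : Integrable (fun x => V x * v x ^ 2) := by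
    refine Continuous.integrable_of_hasCompactSupport (by fun_prop) ?_
    refine hvc.mono ?_
    intro x hx h0
    exact hx (by simp [h0])
  refine ⟨v, hvs, hvc, ?_⟩
  rw [integral_add i1 i2, hI]
  have hle : ∫ x, V x * v x ^ 2 ≤ ∫ x, -(-V x * g x ^ 2) := by
    refine integral_mono i2 (hgcont.integrable_of_hasCompactSupport hgc).neg ?_
    intro x
    show V x * v x ^ 2 ≤ -(-V x * g x ^ 2)
    have hsq : g x ^ 2 ≤ v x ^ 2 := by
      by_cases hx : 1 ≤ dist x x₀
      · rw [g.zero_of_le_dist hx]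
        nlinarith [sq_nonneg (v x)]
      · have hv1 : v x = 1 := by
          apply f.one_of_mem_closedBall
          rw [not_le, Real.dist_eq] at hx
          rw [Metric.mem_closedBall, Real.dist_eq, sub_zero, abs_mul, abs_of_pos he0]
          show _ ≤ (1 : ℝ)
          nlinarith [abs_nonneg (x - x₀)]
        rw [hv1]
        exact pow_le_pow_left₀ g.nonneg g.le_one 2
    nlinarith [hVnonpos x]
  rw [integral_neg, ← hC] at hle
  linarith
end
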